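/- arXiv:2408.00600 — 9 statements merged into one kernel-verified Lean document; each statement's English description precedes it below -/
import Mathlib

section
/- Let M ≥ 1 be an integer, K ≥ 0, ρ ∈ [0,1) with ρ̄² := 1 − ρ², and γ̄ₛ > 0. Set γ̄ := γ̄ₛ(Kρ̄² + 1)/(K + 1) and λ* := M·K·ρ²/(Kρ̄² + 1). Then for every x > 0, ∫₀^∞ [1/(ρ̄²γ̄ₛ)]·f(1, ρ²v/ρ̄²; x/(ρ̄²γ̄ₛ)) · (K+1)·f(M, MK; (K+1)v) dv = ∑_{m=0}^{M−1} ϰ_m · (1/γ̄)·f(M−m, λ*; x/γ̄). In words: the density of the ground-to-air SNR γ_g2a = γ̄ₛ|h|² under delayed-CSI MRT — obtained by compounding the conditional noncentral chi-square law of |h|² given ‖ĥ‖² = v (where h given ĥ is complex Gaussian with mean ρ‖ĥ‖ and variance ρ̄²) against the noncentral chi-square law of ‖ĥ‖² (2M degrees of freedom, noncentrality 2MK, scale 1/(2(K+1))) — equals a mixture of M noncentral chi-square densities with mixing proportions ϰ_m. -/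
open MeasureTheory Real

/-- Noncentral chi-square density with `2k` degrees of freedom, noncentrality `2λ`
and scale `1/2`: `f(k, λ; x) = ∑_{j} (e^{−λ} λ^j / j!) x^{k+j−1} e^{−x} / Γ(k+j)`. -/
noncomputable def ncx2 (k lam x : ℝ) : ℝ :=
  ∑' j : ℕ, (Real.exp (-lam) * lam ^ j / (j.factorial : ℝ)) *
    x ^ (k + (j : ℝ) - 1) * Real.exp (-x) / Real.Gamma (k + (j : ℝ))

/-- Mixing proportions `ϰ_m` of the ground-to-air SNR mixture. -/
noncomputable def mixProp (M : ℕ) (K ρ : ℝ) (m : ℕ) : ℝ :=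
  (Nat.choose (M - 1) m : ℝ) * (1 - ρ ^ 2) ^ m * (K + 1) ^ m * (ρ ^ 2) ^ (M - m - 1) /
    (K * (1 - ρ ^ 2) + 1) ^ (M - 1)

lemma hasSum_cg {f g : ℕ → ℝ} {a : ℝ} (hg : HasSum g a) (h : ∀ i, f i = g i) : HasSum f a := by
  rw [funext h]; exact hg

noncomputable def BB (n : ℕ) (t : ℝ) : ℝ :=
  ∑' j : ℕ, t ^ j / ((j.factorial : ℝ) * ((n + j).factorial : ℝ))

lemma BB_summable (n : ℕ) (t : ℝ) :
    Summable fun j : ℕ => t ^ j / ((j.factorial : ℝ) * ((n + j).factorial : ℝ)) := by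
  refine Summable.of_norm_bounded (g := fun j : ℕ => |t| ^ j / (j.factorial : ℝ))
    (Real.summable_pow_div_factorial |t|) ?_
  intro j
  rw [norm_div, norm_pow, Real.norm_eq_abs, Real.norm_eq_abs,
    abs_of_pos (a := (j.factorial : ℝ) * ((n + j).factorial : ℝ)) (by positivity)]
  have h1 : (1 : ℝ) ≤ ((n + j).factorial : ℝ) := by
    exact_mod_cast Nat.factorial_pos _
  have h0 : (0 : ℝ) < (j.factorial : ℝ) := by positivity
  apply div_le_div_of_nonneg_left (by positivity) h0
  nlinarith

lemma ncx2_eq (n : ℕ) (k lam x : ℝ) (hk : k = (n : ℝ) + 1) :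
    ncx2 k lam x = Real.exp (-lam) * Real.exp (-x) * x ^ n * BB n (lam * x) := by
  unfold ncx2 BB
  rw [← tsum_mul_left]
  congr 1
  funext j
  have e1 : k + (j : ℝ) - 1 = ((n + j : ℕ) : ℝ) := by rw [hk]; push_cast; ring
  have e2 : k + (j : ℝ) = ((n + j : ℕ) : ℝ) + 1 := by rw [hk]; push_cast; ring
  rw [e1, e2, Real.rpow_natCast, Real.Gamma_nat_eq_factorial, mul_pow, pow_add]
  field_simp

/-- binomial sums -/
noncomputable def SS (a : ℕ) (g : ℕ → ℝ) : ℝ :=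
  ∑ k ∈ Finset.range (a + 1), (a.choose k : ℝ) * g k

lemma SS_succ (a : ℕ) (g : ℕ → ℝ) : SS (a + 1) g = SS a g + SS a (fun k => g (k + 1)) := by
  unfold SS
  rw [Finset.sum_range_succ']
  simp only [Nat.choose_succ_succ, Nat.cast_add, add_mul, Finset.sum_add_distrib]
  have h : ∑ k ∈ Finset.range (a + 1), (a.choose k : ℝ) * g k
      = ∑ k ∈ Finset.range (a + 1), (a.choose (k + 1) : ℝ) * g (k + 1)
        + (a.choose 0 : ℝ) * g 0 := by
    rw [← Finset.sum_range_succ' (fun k => (a.choose k : ℝ) * g k), Finset.sum_range_succ _ (a + 1)]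
    simp
  rw [h]
  simp
  ring

lemma SS_add (N j : ℕ) : ∀ g : ℕ → ℝ, SS (N + j) g = SS N (fun n => SS j (fun l => g (n + l))) := by
  induction N with
  | zero => intro g; simp [SS]
  | succ N ih =>
    intro g
    rw [show N + 1 + j = N + j + 1 by ring, SS_succ, SS_succ, ih, ih]
    simp only [add_right_comm]

lemma step1 (a : ℕ) (u : ℝ) :
    HasSum (fun i : ℕ => u ^ i / ((i.factorial : ℝ) * i.factorial) *
      ((a + i).factorial / a.factorial : ℝ))
      (Real.exp u * SS a (fun k => u ^ k / (k.factorial : ℝ))) := by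
  have hz : ∀ k ∉ Finset.range (a + 1), (a.choose k : ℝ) * (u ^ k / (k.factorial : ℝ)) = 0 := by
    intro k hk
    rw [Nat.choose_eq_zero_of_lt (by simpa using hk)]
    simp
  have hA : HasSum (fun k : ℕ => (a.choose k : ℝ) * (u ^ k / (k.factorial : ℝ)))
      (SS a (fun k => u ^ k / (k.factorial : ℝ))) := hasSum_sum_of_ne_finset_zero hz
  have hE : HasSum (fun s : ℕ => u ^ s / (s.factorial : ℝ)) (Real.exp u) := by
    rw [Real.exp_eq_exp_ℝ]; exact NormedSpace.expSeries_div_hasSum_exp u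
  have hs := summable_norm_sum_mul_antidiagonal_of_summable_norm hA.summable.norm hE.summable.norm
  have ht := tsum_mul_tsum_eq_tsum_sum_antidiagonal_of_summable_norm
    hA.summable.norm hE.summable.norm
  rw [hA.tsum_eq, hE.tsum_eq] at ht
  have hh := hs.of_norm.hasSum
  rw [← ht, mul_comm] at hh
  refine hasSum_cg hh fun i => ?_
  have hv := Nat.add_choose_eq a i i
  have h1 : ((a + i).factorial / a.factorial : ℝ) = ((a + i).choose i : ℝ) * i.factorial := by
    rw [Nat.add_choose]
    rw [Nat.cast_div (Nat.factorial_mul_factorial_dvd_factorial_add _ _) (by positivity)]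
    push_cast
    field_simp
  rw [h1, hv]
  push_cast
  rw [Finset.sum_mul, Finset.mul_sum]
  refine Finset.sum_congr rfl ?_
  rintro ⟨k, s⟩ hks
  replace hks := Finset.HasAntidiagonal.mem_antidiagonal.mp hks
  simp only at hks ⊢
  subst hks
  have h2 : ((k + s).choose s : ℝ) = (k + s).factorial / (k.factorial * s.factorial) := by
    rw [Nat.add_choose,
      Nat.cast_div (Nat.factorial_mul_factorial_dvd_factorial_add _ _) (by positivity)]
    push_cast
    rfl
  rw [h2, pow_add]
  field_simp

lemma step2 (N : ℕ) (u w : ℝ) :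
    HasSum (fun j : ℕ => w ^ j / (j.factorial : ℝ) *
        SS (N + j) (fun k => u ^ k / (k.factorial : ℝ)))
      (Real.exp w * SS N (fun n => u ^ n * BB n (w * u))) := by
  have hE : HasSum (fun s : ℕ => w ^ s / (s.factorial : ℝ)) (Real.exp w) := by
    rw [Real.exp_eq_exp_ℝ]; exact NormedSpace.expSeries_div_hasSum_exp w
  have key : ∀ n : ℕ, HasSum (fun j : ℕ => w ^ j / (j.factorial : ℝ) *
      SS j (fun l => u ^ (n + l) / ((n + l).factorial : ℝ)))
      (Real.exp w * (u ^ n * BB n (w * u))) := by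
    intro n
    have hB : HasSum (fun l : ℕ => u ^ n * ((w * u) ^ l / ((l.factorial : ℝ) * ((n + l).factorial : ℝ))))
      (u ^ n * BB n (w * u)) := (BB_summable n (w * u)).hasSum.mul_left _
    have hs := summable_norm_sum_mul_antidiagonal_of_summable_norm
      hB.summable.norm hE.summable.norm
    have ht := tsum_mul_tsum_eq_tsum_sum_antidiagonal_of_summable_norm
      hB.summable.norm hE.summable.norm
    rw [hB.tsum_eq, hE.tsum_eq] at ht
    have hh := hs.of_norm.hasSum
    rw [← ht, mul_comm _ (Real.exp w)] at hh
    refine hasSum_cg hh fun j => ?_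
    rw [SS, Finset.mul_sum, Finset.Nat.sum_antidiagonal_eq_sum_range_succ_mk]
    refine Finset.sum_congr rfl ?_
    intro l hl
    obtain ⟨s, rfl⟩ := Nat.exists_eq_add_of_le (Nat.lt_succ_iff.mp (Finset.mem_range.mp hl))
    simp only [Nat.add_sub_cancel_left]
    rw [Nat.choose_symm_add, Nat.add_choose, Nat.cast_div (Nat.factorial_mul_factorial_dvd_factorial_add _ _) (by positivity)]
    push_cast
    rw [pow_add, pow_add, mul_pow]
    field_simp
  have := hasSum_sum (s := Finset.range (N + 1))
    (fun n _ => (key n).mul_left (N.choose n : ℝ))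
  have hR : (Real.exp w * SS N (fun n => u ^ n * BB n (w * u))) =
    ∑ i ∈ Finset.range (N + 1), (N.choose i : ℝ) * (Real.exp w * (u ^ i * BB i (w * u))) := by
    unfold SS
    rw [Finset.mul_sum]
    refine Finset.sum_congr rfl ?_
    intro n _
    ring
  rw [hR]
  refine hasSum_cg this fun j => ?_
  · rw [SS_add]
    conv_lhs => rw [SS, Finset.mul_sum]
    refine Finset.sum_congr rfl ?_
    intro n _
    ring

lemma step3 (N : ℕ) (u w : ℝ) (hu : 0 ≤ u) (hw : 0 ≤ w) :
    HasSum (fun p : ℕ × ℕ => w ^ p.1 / (p.1.factorial : ℝ) *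
        (u ^ p.2 / ((p.2.factorial : ℝ) * p.2.factorial) *
      ((N + p.1 + p.2).factorial / (N + p.1).factorial : ℝ)))
      (Real.exp u * (Real.exp w * SS N (fun n => u ^ n * BB n (w * u)))) := by
  have h1 : ∀ j : ℕ, HasSum (fun i : ℕ => w ^ j / (j.factorial : ℝ) *
        (u ^ i / ((i.factorial : ℝ) * i.factorial) *
      ((N + j + i).factorial / (N + j).factorial : ℝ)))
      (w ^ j / (j.factorial : ℝ) * (Real.exp u * SS (N + j) (fun k => u ^ k / (k.factorial : ℝ)))) :=
    fun j => (step1 (N + j) u).mul_left _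
  have h2 := (step2 N u w).mul_left (Real.exp u)
  have hS : Summable (fun p : ℕ × ℕ => w ^ p.1 / (p.1.factorial : ℝ) *
        (u ^ p.2 / ((p.2.factorial : ℝ) * p.2.factorial) *
      ((N + p.1 + p.2).factorial / (N + p.1).factorial : ℝ))) := by
    rw [summable_prod_of_nonneg (fun p => by dsimp only [Pi.zero_apply]; positivity)]
    refine ⟨fun j => (h1 j).summable, ?_⟩
    refine (summable_congr fun j => ?_).mpr h2.summable
    rw [(h1 j).tsum_eq]
    ring
  have h3 := hS.hasSum.prod_fiberwise h1
  have h4 : (fun j : ℕ => w ^ j / (j.factorial : ℝ) *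
      (Real.exp u * SS (N + j) (fun k => u ^ k / (k.factorial : ℝ)))) =
      fun j : ℕ => Real.exp u * (w ^ j / (j.factorial : ℝ) *
        SS (N + j) (fun k => u ^ k / (k.factorial : ℝ))) := by
    funext j; ring
  rw [h4] at h3
  rw [← h3.unique h2]
  exact hS.hasSum

lemma int_pow (n : ℕ) (s : ℝ) (hs : 0 < s) :
    ∫ v in Set.Ioi (0 : ℝ), v ^ n * Real.exp (-(s * v)) = n.factorial / s ^ (n + 1) := by
  have h := Real.integral_rpow_mul_exp_neg_mul_Ioi (a := (n : ℝ) + 1) (r := s) (by positivity) hs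
  rw [Real.Gamma_nat_eq_factorial] at h
  simp only [add_sub_cancel_right, Real.rpow_natCast] at h
  rw [h]
  rw [show (n : ℝ) + 1 = ((n + 1 : ℕ) : ℝ) by push_cast; rfl, Real.rpow_natCast, div_pow, one_pow]
  ring

lemma int_pow_integrable (n : ℕ) (s : ℝ) (hs : 0 < s) :
    IntegrableOn (fun v : ℝ => v ^ n * Real.exp (-(s * v))) (Set.Ioi 0) := by
  by_contra hc
  have h := int_pow n s hs
  rw [integral_undef hc] at h
  have : (0 : ℝ) < n.factorial / s ^ (n + 1) := by positivity
  linarith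

lemma core (N : ℕ) (A C s : ℝ) (hA : 0 ≤ A) (hC : 0 ≤ C) (hs : 0 < s) :
    ∫ v in Set.Ioi (0 : ℝ), Real.exp (-(s * v)) * v ^ N * BB 0 (A * v) * BB N (C * v)
      = (1 / s ^ (N + 1)) * (Real.exp (A / s) * (Real.exp (C / s) *
        SS N (fun n => (A / s) ^ n * BB n (C / s * (A / s))))) := by
  have h3 := (step3 N (A / s) (C / s) (by positivity) (by positivity)).mul_left (1 / s ^ (N + 1))
  let c : ℕ × ℕ → ℝ := fun p => C ^ p.1 / ((p.1.factorial : ℝ) * (N + p.1).factorial) *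
    (A ^ p.2 / ((p.2.factorial : ℝ) * p.2.factorial))
  have hc : ∀ p, 0 ≤ c p := fun p => by dsimp only [c]; positivity
  let F : ℕ × ℕ → ℝ → ℝ := fun p v => c p * (v ^ (N + p.1 + p.2) * Real.exp (-(s * v)))
  have hFint : ∀ p, Integrable (F p) (volume.restrict (Set.Ioi 0)) := fun p =>
    (int_pow_integrable (N + p.1 + p.2) s hs).const_mul (c p)
  have hFval : ∀ p, ∫ v in Set.Ioi (0 : ℝ), F p v = 1 / s ^ (N + 1) *
      ((C / s) ^ p.1 / (p.1.factorial : ℝ) *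
        ((A / s) ^ p.2 / ((p.2.factorial : ℝ) * p.2.factorial) *
      ((N + p.1 + p.2).factorial / (N + p.1).factorial : ℝ))) := by
    intro p
    dsimp only [F, c]
    rw [integral_const_mul, int_pow _ _ hs, div_pow, div_pow,
      show N + p.1 + p.2 + 1 = (N + 1) + p.1 + p.2 by ring, pow_add, pow_add]
    field_simp
  have hFn : ∀ p, ∫ v in Set.Ioi (0 : ℝ), ‖F p v‖ = ∫ v in Set.Ioi (0 : ℝ), F p v := by
    intro p
    refine setIntegral_congr_fun measurableSet_Ioi ?_
    intro v hv
    have hv' : (0 : ℝ) < v := hv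
    have := hc p
    exact Real.norm_of_nonneg (by dsimp only [F]; positivity)
  have hI := hasSum_integral_of_summable_integral_norm hFint (by
    simp only [hFn, hFval]
    exact h3.summable)
  simp only [hFval] at hI
  rw [← hI.unique h3]
  refine setIntegral_congr_fun measurableSet_Ioi ?_
  intro v hv
  dsimp only
  have hm := tsum_mul_tsum_of_summable_norm (BB_summable N (C * v)).norm
    (BB_summable 0 (A * v)).norm
  rw [mul_assoc, mul_comm (BB 0 _)]
  unfold BB
  rw [hm, ← tsum_mul_left]
  congr 1
  funext p
  dsimp only [F, c]
  rw [pow_add, pow_add, mul_pow, mul_pow, zero_add]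
  ring

/-- The compound density of the G2A SNR under delayed-CSI MRT equals a mixture of `M`
noncentral chi-square densities. -/
theorem stmt0 (M : ℕ) (hM : 1 ≤ M) (K : ℝ) (hK : 0 ≤ K) (ρ : ℝ)
    (hρ : ρ ∈ Set.Ico (0 : ℝ) 1) (γs : ℝ) (hγs : 0 < γs) (x : ℝ) (hx : 0 < x) :
    (∫ v in Set.Ioi (0 : ℝ),
        (1 / ((1 - ρ ^ 2) * γs)) *
          ncx2 1 (ρ ^ 2 * v / (1 - ρ ^ 2)) (x / ((1 - ρ ^ 2) * γs)) *
        ((K + 1) * ncx2 (M : ℝ) ((M : ℝ) * K) ((K + 1) * v)))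
      = ∑ m ∈ Finset.range M, mixProp M K ρ m *
          ((1 / (γs * (K * (1 - ρ ^ 2) + 1) / (K + 1))) *
            ncx2 ((M : ℝ) - (m : ℝ)) ((M : ℝ) * K * ρ ^ 2 / (K * (1 - ρ ^ 2) + 1))
              (x / (γs * (K * (1 - ρ ^ 2) + 1) / (K + 1)))) := by
  obtain ⟨N, rfl⟩ : ∃ N, M = N + 1 := ⟨M - 1, by omega⟩
  obtain ⟨h0, h1⟩ := hρ
  have hr : 0 < 1 - ρ ^ 2 := by nlinarith
  obtain ⟨r, hrd⟩ : ∃ r, r = 1 - ρ ^ 2 := ⟨_, rfl⟩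
  have hρr : ρ ^ 2 = 1 - r := by linarith
  have hr1 : 0 ≤ 1 - r := by rw [← hρr]; positivity
  unfold mixProp
  rw [← hrd] at hr ⊢
  rw [hρr]
  obtain ⟨D, hD⟩ : ∃ D, D = K * r + 1 := ⟨_, rfl⟩
  have hDp : 0 < D := by rw [hD]; positivity
  rw [← hD]
  obtain ⟨L, hL⟩ : ∃ L, L = ((N + 1 : ℕ) : ℝ) * K := ⟨_, rfl⟩
  have hLp : 0 ≤ L := by rw [hL]; positivity
  rw [← hL]
  have hcore := core N ((1 - r) / r * (x / (r * γs))) (L * (K + 1)) (D / r)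
    (by positivity) (by positivity) (by positivity)
  have hI : (∫ v in Set.Ioi (0 : ℝ),
        (1 / (r * γs)) * ncx2 1 ((1 - r) * v / r) (x / (r * γs)) *
        ((K + 1) * ncx2 ((N + 1 : ℕ) : ℝ) L ((K + 1) * v)))
      = (1 / (r * γs) * Real.exp (-(x / (r * γs))) * (K + 1) ^ (N + 1) * Real.exp (-L)) *
       ∫ v in Set.Ioi (0 : ℝ), Real.exp (-(D / r * v)) * v ^ N *
        BB 0 ((1 - r) / r * (x / (r * γs)) * v) * BB N (L * (K + 1) * v) := by
    rw [← integral_const_mul]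
    refine setIntegral_congr_fun measurableSet_Ioi ?_
    intro v hv
    dsimp only
    rw [ncx2_eq 0 1 _ _ (by simp), ncx2_eq N ((N + 1 : ℕ) : ℝ) _ _ (by push_cast; rfl)]
    have e : Real.exp (-(D / r * v)) = Real.exp (-((1 - r) * v / r)) * Real.exp (-((K + 1) * v)) := by
      rw [← Real.exp_add]; congr 1; rw [hD]; field_simp; ring
    rw [e, mul_pow, pow_succ (K + 1), show (1 - r) * v / r * (x / (r * γs)) =
      (1 - r) / r * (x / (r * γs)) * v by ring, ← mul_assoc L]
    ring
  rw [hI, hcore, ← Finset.sum_range_reflect, SS]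
  simp only [Finset.mul_sum]
  refine Finset.sum_congr rfl ?_
  intro n hn
  obtain ⟨m, rfl⟩ := Nat.exists_eq_add_of_le (Nat.lt_succ_iff.mp (Finset.mem_range.mp hn))
  have i1 : n + m + 1 - 1 - n = m := by omega
  have i2 : n + m + 1 - m - 1 = n := by omega
  rw [i1, i2, ncx2_eq n _ _ _ (by push_cast; ring)]
  simp only [Nat.add_sub_cancel]
  have e1 : L * (K + 1) / (D / r) * ((1 - r) / r * (x / (r * γs)) / (D / r))
      = L * (1 - r) / D * (x / (γs * D / (K + 1))) := by
    field_simp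
  have e2 : Real.exp (-(x / (r * γs))) * Real.exp (-L) *
      Real.exp ((1 - r) / r * (x / (r * γs)) / (D / r)) * Real.exp (L * (K + 1) / (D / r))
      = Real.exp (-(L * (1 - r) / D)) * Real.exp (-(x / (γs * D / (K + 1)))) := by
    simp only [← Real.exp_add]
    congr 1
    have : D ≠ 0 := hDp.ne'
    field_simp
    rw [hD]
    ring
  have e3 : ((n + m).choose m : ℝ) = ((n + m).choose n : ℝ) := by
    rw [Nat.choose_symm_add]
  rw [e1, e3]
  obtain ⟨b, hb⟩ : ∃ b, b = BB n (L * (1 - r) / D * (x / (γs * D / (K + 1)))) := ⟨_, rfl⟩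
  rw [← hb]
  have e4 : (1 / (r * γs)) * (K + 1) ^ (n + m + 1) * (1 / (D / r) ^ (n + m + 1)) *
      ((1 - r) / r * (x / (r * γs)) / (D / r)) ^ n =
      r ^ m * (K + 1) ^ m * (1 - r) ^ n / D ^ (n + m) * (1 / (γs * D / (K + 1))) *
        (x / (γs * D / (K + 1))) ^ n := by
    have : D ≠ 0 := hDp.ne'
    simp only [div_pow, mul_pow, pow_add, pow_one]
    field_simp
  calc _ = ((n + m).choose n : ℝ) * b * ((1 / (r * γs)) * (K + 1) ^ (n + m + 1) *
        (1 / (D / r) ^ (n + m + 1)) * ((1 - r) / r * (x / (r * γs)) / (D / r)) ^ n) *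
        (Real.exp (-(x / (r * γs))) * Real.exp (-L) *
      Real.exp ((1 - r) / r * (x / (r * γs)) / (D / r)) * Real.exp (L * (K + 1) / (D / r))) := by
        ring
    _ = _ := by rw [e4, e2]; ring
end

section
/- For every integer k ≥ 1, every λ > 0 and every x > 0, the cumulative distribution function of the noncentral chi-square density equals one minus a Marcum Q-function: ∫₀^x f(k, λ; t) dt = 1 − (2λ)^{(1−k)/2} ∫_{√(2x)}^∞ t^k e^{−(t² + 2λ)/2} I_{k−1}(√(2λ)·t) dt. -/
open MeasureTheory Real

/-- Modified Bessel function of the first kind of natural order `n`. -/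
noncomputable def besselI (n : ℕ) (z : ℝ) : ℝ :=
  ∑' m : ℕ, (z / 2) ^ (2 * m + n) / ((m.factorial : ℝ) * ((m + n).factorial : ℝ))

noncomputable def ncTerm (n : ℕ) (lam : ℝ) (j : ℕ) (t : ℝ) : ℝ :=
  (Real.exp (-lam) * lam ^ j / (j.factorial : ℝ)) / ((n + j).factorial : ℝ) *
    (Real.exp (-t) * t ^ (n + j))

lemma ncx2_eq_s3 (n : ℕ) (lam t : ℝ) :
    ncx2 ((n + 1 : ℕ) : ℝ) lam t = ∑' j, ncTerm n lam j t := by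
  unfold ncx2 ncTerm
  refine tsum_congr fun j => ?_
  have h1 : ((n + 1 : ℕ) : ℝ) + (j : ℝ) - 1 = ((n + j : ℕ) : ℝ) := by push_cast; ring
  have h2 : ((n + 1 : ℕ) : ℝ) + (j : ℝ) = ((n + j : ℕ) : ℝ) + 1 := by push_cast; ring
  rw [h1, h2, Real.rpow_natCast, Real.Gamma_nat_eq_factorial]
  ring

lemma pow_int (m : ℕ) :
    IntegrableOn (fun t : ℝ => Real.exp (-t) * t ^ m) (Set.Ioi 0) ∧
    ∫ t in Set.Ioi (0:ℝ), Real.exp (-t) * t ^ m = (m.factorial : ℝ) := by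
  have hpos : (0:ℝ) < (m:ℝ) + 1 := by positivity
  have h := Real.GammaIntegral_convergent hpos
  have h' := Real.Gamma_eq_integral hpos
  simp only [add_sub_cancel_right, Real.rpow_natCast] at h h'
  exact ⟨h, by rw [← h', Real.Gamma_nat_eq_factorial]⟩

lemma ncTerm_integral (n : ℕ) (lam : ℝ) (j : ℕ) :
    ∫ t in Set.Ioi (0:ℝ), ncTerm n lam j t = Real.exp (-lam) * (lam ^ j / (j.factorial : ℝ)) := by
  unfold ncTerm
  rw [integral_const_mul, (pow_int (n + j)).2]
  have : ((n + j).factorial : ℝ) ≠ 0 := by positivity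
  field_simp

lemma ncx2_total (n : ℕ) (lam : ℝ) (hlam : 0 < lam) :
    ∫ t in Set.Ioi (0:ℝ), ncx2 ((n + 1 : ℕ) : ℝ) lam t = 1 := by
  simp only [ncx2_eq_s3]
  have hs : HasSum (fun j : ℕ => Real.exp (-lam) * (lam ^ j / (j.factorial : ℝ))) 1 := by
    have := (NormedSpace.expSeries_div_hasSum_exp (𝔸 := ℝ) lam).mul_left (Real.exp (-lam))
    rw [← Real.exp_eq_exp_ℝ, ← Real.exp_add] at this
    simpa using this
  have h := hasSum_integral_of_summable_integral_norm (μ := volume.restrict (Set.Ioi (0:ℝ)))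
    (F := fun j t => ncTerm n lam j t) (fun j => ((pow_int (n + j)).1).const_mul _) (by
      refine hs.summable.congr fun j => ?_
      rw [← ncTerm_integral n lam j]
      refine setIntegral_congr_fun measurableSet_Ioi fun t ht => ?_
      have ht : (0:ℝ) < t := ht
      have : 0 ≤ ncTerm n lam j t := by unfold ncTerm; positivity
      simp [abs_of_nonneg this])
  simp only [ncTerm_integral] at h
  exact h.unique hs

lemma pointwise_eq (n : ℕ) (lam : ℝ) (hlam : 0 < lam) (t : ℝ) :
    (2 * lam) ^ ((1 - ((n + 1 : ℕ) : ℝ)) / 2) * (t ^ (n + 1) * Real.exp (-(t ^ 2 + 2 * lam) / 2) *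
      besselI n (Real.sqrt (2 * lam) * t)) = t * ncx2 ((n + 1 : ℕ) : ℝ) lam (t ^ 2 / 2) := by
  have h0 : 0 < 2 * lam := by positivity
  have hs : 0 < Real.sqrt (2 * lam) := Real.sqrt_pos.2 h0
  have hp : (2 * lam) ^ ((1 - ((n + 1 : ℕ) : ℝ)) / 2) = (Real.sqrt (2 * lam) ^ n)⁻¹ := by
    rw [Real.sqrt_eq_rpow, ← Real.rpow_natCast, ← Real.rpow_mul h0.le, ← Real.rpow_neg h0.le]
    congr 1; push_cast; ring
  have he : Real.exp (-(t ^ 2 + 2 * lam) / 2) = Real.exp (-lam) * Real.exp (-(t ^ 2 / 2)) := by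
    rw [← Real.exp_add]; congr 1; ring
  rw [hp, he, ncx2_eq_s3, besselI, ← tsum_mul_left, ← tsum_mul_left, ← tsum_mul_left]
  refine tsum_congr fun m => ?_
  unfold ncTerm
  have hq : (Real.sqrt (2 * lam) * t / 2) ^ (2 * m + n)
      = lam ^ m * (t ^ 2 / 2) ^ m * (Real.sqrt (2 * lam) ^ n * t ^ n / 2 ^ n) := by
    have h3 : (Real.sqrt (2 * lam) * t / 2) ^ 2 = lam * (t ^ 2 / 2) := by
      rw [div_pow, mul_pow, Real.sq_sqrt h0.le]; ring
    rw [pow_add, pow_mul, h3, mul_pow, div_pow _ _ n, mul_pow _ _ n]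
  rw [hq, add_comm m n, pow_add (t ^ 2 / 2) n m, div_pow (t^2) 2 n]
  have : Real.sqrt (2 * lam) ^ n ≠ 0 := by positivity
  field_simp
  ring

theorem stmt3 (k : ℕ) (hk : 1 ≤ k) (lam : ℝ) (hlam : 0 < lam) (x : ℝ) (hx : 0 < x) :
    (∫ t in (0 : ℝ)..x, ncx2 (k : ℝ) lam t)
      = 1 - (2 * lam) ^ ((1 - (k : ℝ)) / 2) *
          ∫ t in Set.Ioi (Real.sqrt (2 * x)),
            t ^ k * Real.exp (-(t ^ 2 + 2 * lam) / 2) *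
              besselI (k - 1) (Real.sqrt (2 * lam) * t) := by
  obtain ⟨n, rfl⟩ : ∃ n, k = n + 1 := ⟨k - 1, by omega⟩
  rw [Nat.add_sub_cancel, ← integral_const_mul]
  simp only [pointwise_eq n lam hlam]
  have htot := ncx2_total n lam hlam
  have hint : IntegrableOn (ncx2 ((n + 1 : ℕ) : ℝ) lam) (Set.Ioi 0) := by
    by_contra hc
    rw [integral_undef hc] at htot
    exact zero_ne_one htot
  have hsplit : (∫ t in (0 : ℝ)..x, ncx2 ((n + 1 : ℕ) : ℝ) lam t)
      + ∫ t in Set.Ioi x, ncx2 ((n + 1 : ℕ) : ℝ) lam t = 1 := by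
    rw [intervalIntegral.integral_of_le hx.le, ← htot, ← Set.Ioc_union_Ioi_eq_Ioi hx.le]
    rw [setIntegral_union (Set.Ioc_disjoint_Ioi le_rfl) measurableSet_Ioi
      (hint.mono_set Set.Ioc_subset_Ioi_self) (hint.mono_set (Set.Ioi_subset_Ioi hx.le))]
  have hs0 : 0 ≤ Real.sqrt (2 * x) := Real.sqrt_nonneg _
  have himg : (fun t : ℝ => t ^ 2 / 2) '' Set.Ioi (Real.sqrt (2 * x)) = Set.Ioi x := by
    ext y
    simp only [Set.mem_image, Set.mem_Ioi]
    constructor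
    · rintro ⟨t, ht, rfl⟩
      have := (Real.sqrt_lt' (hs0.trans_lt ht)).1 ht
      linarith
    · intro hy
      refine ⟨Real.sqrt (2 * y), Real.sqrt_lt_sqrt (by positivity) (by linarith), ?_⟩
      rw [Real.sq_sqrt (by linarith)]; ring
  have hcv := integral_image_eq_integral_abs_deriv_smul (s := Set.Ioi (Real.sqrt (2 * x)))
    (f := fun t : ℝ => t ^ 2 / 2) (f' := fun t => t) measurableSet_Ioi
    (fun t _ => by
      have := ((hasDerivAt_pow 2 t).div_const 2).hasDerivWithinAt (s := Set.Ioi (Real.sqrt (2 * x)))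
      simpa using this)
    (by
      intro a ha b hb hab
      have ha : 0 < a := hs0.trans_lt ha
      have hb : 0 < b := hs0.trans_lt hb
      have hab : a ^ 2 / 2 = b ^ 2 / 2 := hab
      nlinarith [mul_pos ha hb, sq_nonneg (a - b), (sq_eq_sq₀ ha.le hb.le).1 (by linarith)])
    (ncx2 ((n + 1 : ℕ) : ℝ) lam)
  rw [himg] at hcv
  rw [eq_sub_iff_add_eq, ← hsplit, hcv]
  congr 1
  refine setIntegral_congr_fun measurableSet_Ioi fun t ht => ?_
  have ht : 0 < t := hs0.trans_lt ht
  simp [abs_of_pos ht]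
end

section
/- Let M ≥ 1 be an integer, K ≥ 0, ρ ∈ [0,1) with ρ̄² := 1 − ρ², and γ̄ₛ > 0. Set Δ₁ := γ̄ₛ ρ̄², Δ₂ := γ̄ₛ(K ρ̄² + 1)/(K + 1), γ̄ := Δ₂ and λ* := M K ρ²/(K ρ̄² + 1). Then for every s ≥ 0, the Laplace transform of the ground-to-air SNR density satisfies ∫₀^∞ e^{−s x} ∑_{m=0}^{M−1} ϰ_m (1/γ̄) f(M−m, λ*; x/γ̄) dx = e^{−MK} · (1 + Δ₁ s)^{M−1} (1 + Δ₂ s)^{−M} · exp( M K (1 + Δ₁ s)/(1 + Δ₂ s) ). -/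
open MeasureTheory Real

lemma base_int (a r : ℝ) (ha : 0 < a) (hr : 0 < r) :
    IntegrableOn (fun t : ℝ => t ^ (a - 1) * Real.exp (-(r * t))) (Set.Ioi 0) := by
  apply Integrable.of_integral_ne_zero
  rw [Real.integral_rpow_mul_exp_neg_mul_Ioi ha hr]
  have := Real.Gamma_pos_of_pos ha
  positivity

lemma ncx2_laplace (k lam c : ℝ) (hk : 0 < k) (hl : 0 ≤ lam) (hc : 0 ≤ c) :
    ∫ y in Set.Ioi (0:ℝ), Real.exp (-(c * y)) * ncx2 k lam y
      = (1 + c) ^ (-k) * Real.exp (-lam + lam / (1 + c)) := by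
  have hr : 0 < 1 + c := by linarith
  set C : ℕ → ℝ := fun j => Real.exp (-lam) * lam ^ j / (j.factorial : ℝ) / Real.Gamma (k + j)
    with hC
  have hG : ∀ j : ℕ, 0 < Real.Gamma (k + j) := fun j => Real.Gamma_pos_of_pos (by positivity)
  have hC0 : ∀ j, 0 ≤ C j := fun j => by
    have := hG j
    simp only [hC]; positivity
  set F : ℕ → ℝ → ℝ := fun j t => C j * (t ^ (k + j - 1) * Real.exp (-((1 + c) * t))) with hF
  have hFi : ∀ j, IntegrableOn (F j) (Set.Ioi 0) := fun j =>
    (base_int (k + j) (1 + c) (by positivity) hr).const_mul (C j)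
  have hFv : ∀ j, ∫ t in Set.Ioi (0:ℝ), F j t
      = (1 + c) ^ (-k) * Real.exp (-lam) * ((lam / (1 + c)) ^ j / (j.factorial : ℝ)) := fun j => by
    simp only [hF]
    rw [integral_const_mul, Real.integral_rpow_mul_exp_neg_mul_Ioi (by positivity) hr]
    have e : (1 / (1 + c)) ^ (k + (j:ℝ)) = (1 + c) ^ (-k) * (1 / (1 + c)) ^ j := by
      rw [Real.rpow_add (by positivity), Real.rpow_natCast, one_div, Real.inv_rpow hr.le,
        Real.rpow_neg hr.le]
    rw [e]
    have := (hG j).ne'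
    simp only [hC]
    rw [div_pow, div_pow, one_pow]
    field_simp
  have hnorm : ∀ j, ∫ t in Set.Ioi (0:ℝ), ‖F j t‖ = ∫ t in Set.Ioi (0:ℝ), F j t := fun j => by
    apply setIntegral_congr_fun measurableSet_Ioi
    intro t ht
    have ht' : 0 < t := ht
    have := hC0 j
    simp only [hF]
    rw [Real.norm_of_nonneg]
    positivity
  have hexp : HasSum (fun j : ℕ => (lam / (1 + c)) ^ j / (j.factorial : ℝ))
      (Real.exp (lam / (1 + c))) := by
    rw [Real.exp_eq_exp_ℝ]
    exact NormedSpace.expSeries_div_hasSum_exp (lam / (1 + c))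
  have hs := hexp.mul_left ((1 + c) ^ (-k) * Real.exp (-lam))
  have hmain := hasSum_integral_of_summable_integral_norm (F := F)
    (μ := volume.restrict (Set.Ioi 0)) hFi (by
      simp only [hnorm, hFv]; exact hs.summable)
  simp only [hFv] at hmain
  have huniq := hmain.unique hs
  rw [Real.exp_add, ← mul_assoc, ← huniq]
  apply setIntegral_congr_fun measurableSet_Ioi
  intro t ht
  simp only [ncx2, hF, hC]
  rw [← tsum_mul_left]
  congr 1
  ext j
  rw [show -((1 + c) * t) = -(c * t) + -t by ring, Real.exp_add]
  ring

lemma comp_int (k lam s g : ℝ) (hk : 0 < k) (hl : 0 ≤ lam) (hs : 0 ≤ s) (hg : 0 < g) :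
    ∫ x in Set.Ioi (0:ℝ), Real.exp (-(s * x)) * (1 / g * ncx2 k lam (x / g))
      = (1 + g * s) ^ (-k) * Real.exp (-lam + lam / (1 + g * s)) := by
  rw [← ncx2_laplace k lam (g * s) hk hl (by positivity)]
  have h := integral_comp_mul_right_Ioi
    (fun y => Real.exp (-((g * s) * y)) * ncx2 k lam y) 0 (inv_pos.2 hg)
  simp only [zero_mul, inv_inv, smul_eq_mul] at h
  have h2 : (∫ y in Set.Ioi (0:ℝ), Real.exp (-((g * s) * y)) * ncx2 k lam y)
    = 1 / g * ∫ x in Set.Ioi (0:ℝ), Real.exp (-(g * s * (x * g⁻¹))) * ncx2 k lam (x * g⁻¹) := by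
    rw [h]; field_simp
  rw [h2, ← integral_const_mul]
  congr 1
  ext x
  rw [show g * s * (x * g⁻¹) = s * x by field_simp, div_eq_mul_inv x g]
  ring

/-- Laplace transform of the ground-to-air SNR density:
with `Δ₁ = γ̄ₛ ρ̄²`, `Δ₂ = γ̄ₛ (Kρ̄²+1)/(K+1)`, `γ̄ = Δ₂`, `λ* = MKρ²/(Kρ̄²+1)`,
`∫₀^∞ e^{−sx} ∑_m ϰ_m γ̄⁻¹ f(M−m, λ*; x/γ̄) dx
  = e^{−MK} (1+Δ₁s)^{M−1} (1+Δ₂s)^{−M} exp(MK(1+Δ₁s)/(1+Δ₂s))`. -/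
theorem stmt5 (M : ℕ) (hM : 1 ≤ M) (K : ℝ) (hK : 0 ≤ K) (ρ : ℝ)
    (hρ : ρ ∈ Set.Ico (0 : ℝ) 1) (γs : ℝ) (hγs : 0 < γs) (s : ℝ) (hs : 0 ≤ s) :
    (∫ x in Set.Ioi (0 : ℝ),
        Real.exp (-(s * x)) * ∑ m ∈ Finset.range M, mixProp M K ρ m *
          ((1 / (γs * (K * (1 - ρ ^ 2) + 1) / (K + 1))) *
            ncx2 ((M : ℝ) - (m : ℝ)) ((M : ℝ) * K * ρ ^ 2 / (K * (1 - ρ ^ 2) + 1))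
              (x / (γs * (K * (1 - ρ ^ 2) + 1) / (K + 1)))))
      = Real.exp (-((M : ℝ) * K)) *
          (1 + γs * (1 - ρ ^ 2) * s) ^ (M - 1) *
          (1 + γs * (K * (1 - ρ ^ 2) + 1) / (K + 1) * s) ^ (-(M : ℝ)) *
          Real.exp ((M : ℝ) * K * (1 + γs * (1 - ρ ^ 2) * s) /
            (1 + γs * (K * (1 - ρ ^ 2) + 1) / (K + 1) * s)) := by
  obtain ⟨hρ0, hρ1⟩ := hρ
  have hq : 0 < 1 - ρ ^ 2 := by nlinarith
  have hD : 0 < K * (1 - ρ ^ 2) + 1 := by positivity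
  have hK1 : 0 < K + 1 := by positivity
  set D := K * (1 - ρ ^ 2) + 1 with hDd
  set g := γs * D / (K + 1) with hg
  have hg0 : 0 < g := by positivity
  set lam := (M : ℝ) * K * ρ ^ 2 / D with hlam
  have hl0 : 0 ≤ lam := by positivity
  have hu : 0 < 1 + g * s := by positivity
  have hk : ∀ m ∈ Finset.range M, 0 < (M : ℝ) - m := fun m hm => by
    have : (m : ℝ) < M := by exact_mod_cast Finset.mem_range.1 hm
    linarith
  have hint : ∀ m ∈ Finset.range M, IntegrableOn (fun x : ℝ =>
      mixProp M K ρ m * (Real.exp (-(s * x)) * (1 / g * ncx2 ((M : ℝ) - m) lam (x / g))))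
      (Set.Ioi 0) := fun m hm => by
    apply Integrable.const_mul
    apply Integrable.of_integral_ne_zero
    rw [comp_int _ _ _ _ (hk m hm) hl0 hs hg0]
    positivity
  have h1 : ∀ x : ℝ, Real.exp (-(s * x)) * ∑ m ∈ Finset.range M, mixProp M K ρ m *
      (1 / g * ncx2 ((M : ℝ) - m) lam (x / g)) = ∑ m ∈ Finset.range M,
      mixProp M K ρ m * (Real.exp (-(s * x)) * (1 / g * ncx2 ((M : ℝ) - m) lam (x / g))) := by
    intro x
    rw [Finset.mul_sum]
    exact Finset.sum_congr rfl fun m _ => by ring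
  simp only [h1]
  rw [integral_finsetSum _ hint]
  simp only [integral_const_mul]
  have h2 : ∀ m ∈ Finset.range M, mixProp M K ρ m * (∫ x in Set.Ioi (0:ℝ),
      Real.exp (-(s * x)) * (1 / g * ncx2 ((M : ℝ) - m) lam (x / g)))
      = (1 + g * s) ^ (-(M : ℝ)) * Real.exp (-lam + lam / (1 + g * s)) / D ^ (M - 1) *
        (((1 - ρ ^ 2) * (K + 1) * (1 + g * s)) ^ m * (ρ ^ 2) ^ (M - 1 - m) *
          (Nat.choose (M - 1) m : ℝ)) := fun m hm => by
    rw [comp_int _ _ _ _ (hk m hm) hl0 hs hg0, show -((M : ℝ) - m) = -(M : ℝ) + m by ring,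
      Real.rpow_add hu, Real.rpow_natCast, mixProp, ← hDd, mul_pow, mul_pow,
      show M - m - 1 = M - 1 - m by omega]
    ring
  rw [Finset.sum_congr rfl h2, ← Finset.mul_sum]
  have h3 := add_pow ((1 - ρ ^ 2) * (K + 1) * (1 + g * s)) (ρ ^ 2) (M - 1)
  rw [show M - 1 + 1 = M by omega] at h3
  rw [← h3]
  have h4 : (1 - ρ ^ 2) * (K + 1) * (1 + g * s) + ρ ^ 2 = D * (1 + γs * (1 - ρ ^ 2) * s) := by
    have : (K + 1) * g = γs * D := by rw [hg]; field_simp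
    linear_combination (1 - ρ ^ 2) * s * this - hDd
  have h5 : -lam + lam / (1 + g * s)
      = -((M : ℝ) * K) + (M : ℝ) * K * (1 + γs * (1 - ρ ^ 2) * s) / (1 + g * s) := by
    have e1 : lam * g = M * K * ρ ^ 2 * γs / (K + 1) := by rw [hlam, hg]; field_simp
    have e2 : lam * g = M * K * (g - γs * (1 - ρ ^ 2)) := by
      rw [e1, hg, hDd]; field_simp; ring
    field_simp
    linear_combination (-s) * e2
  rw [h4, h5, Real.exp_add, mul_pow]
  field_simp
end

section
/- Fix a ∈ ℝ and natural numbers ν and n with n ≤ ν. Then the n-th iterated derivative of F_ν equals F_{ν−n}, i.e. for every x ∈ ℝ, (d/dx)^n [ ∑_{m=0}^∞ a^m x^{m+ν}/(m!(m+ν)!) ] = ∑_{m=0}^∞ a^m x^{m+ν−n}/(m!(m+ν−n)!). Equivalently, for a > 0 and x > 0, (d/dx)^n [ x^{ν/2} I_ν(2√(a x)) ] = a^{n/2} x^{(ν−n)/2} I_{ν−n}(2√(a x)), where I_ν is the modified Bessel function of the first kind. -/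
open Real

/-- `F_ν(x) = ∑_m a^m x^{m+ν} / (m! (m+ν)!)`. -/
noncomputable def Fser (a : ℝ) (ν : ℕ) (x : ℝ) : ℝ :=
  ∑' m : ℕ, a ^ m * x ^ (m + ν) / ((m.factorial : ℝ) * ((m + ν).factorial : ℝ))

theorem Fser_hasDerivAt (a : ℝ) (k : ℕ) (x : ℝ) :
    HasDerivAt (Fser a (k + 1)) (Fser a k x) x := by
  set R : ℝ := |x| + 1 with hR
  have hR0 : 0 < R := by positivity
  have hu : Summable (fun m : ℕ => R ^ k * ((|a| * R) ^ m / (m.factorial : ℝ))) :=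
    (Real.summable_pow_div_factorial (|a| * R)).mul_left _
  have hx : x ∈ Metric.ball (0 : ℝ) R := by
    simp [hR]
  have h0 : (0 : ℝ) ∈ Metric.ball (0 : ℝ) R := by
    simp [hR0]
  refine hasDerivAt_tsum_of_isPreconnected
    (g := fun (m : ℕ) (y : ℝ) =>
      a ^ m * y ^ (m + (k + 1)) / ((m.factorial : ℝ) * ((m + (k + 1)).factorial : ℝ)))
    (g' := fun (m : ℕ) (y : ℝ) =>
      a ^ m * y ^ (m + k) / ((m.factorial : ℝ) * ((m + k).factorial : ℝ)))
    hu Metric.isOpen_ball (convex_ball (0 : ℝ) R).isPreconnected ?_ ?_ h0 ?_ hx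
  · intro m y _
    have h := ((hasDerivAt_pow (m + k + 1) y).const_mul (a ^ m)).div_const
      ((m.factorial : ℝ) * ((m + k + 1).factorial : ℝ))
    have e : a ^ m * (((m + k + 1 : ℕ) : ℝ) * y ^ (m + k + 1 - 1)) /
        ((m.factorial : ℝ) * ((m + k + 1).factorial : ℝ)) =
        a ^ m * y ^ (m + k) / ((m.factorial : ℝ) * ((m + k).factorial : ℝ)) := by
      have h1 : (m.factorial : ℝ) ≠ 0 := by positivity
      have h2 : ((m + k).factorial : ℝ) ≠ 0 := by positivity
      have h3 : ((m + k + 1 : ℕ) : ℝ) ≠ 0 := by positivity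
      rw [Nat.factorial_succ, Nat.cast_mul, Nat.add_sub_cancel]
      field_simp
    rw [e] at h
    exact h
  · intro m y hy
    have hy' : |y| ≤ R := by
      have : |y| < R := by simpa using hy
      exact this.le
    have h1 : (1 : ℝ) ≤ ((m + k).factorial : ℝ) := by
      exact_mod_cast Nat.succ_le_of_lt (Nat.factorial_pos _)
    have h2 : (0 : ℝ) < (m.factorial : ℝ) := by positivity
    rw [Real.norm_eq_abs, abs_div, abs_mul, abs_pow, abs_pow,
      abs_of_pos (by positivity : (0 : ℝ) < (m.factorial : ℝ) * ((m + k).factorial : ℝ))]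
    calc |a| ^ m * |y| ^ (m + k) / ((m.factorial : ℝ) * ((m + k).factorial : ℝ))
        ≤ |a| ^ m * R ^ (m + k) / ((m.factorial : ℝ) * 1) := by gcongr
      _ = R ^ k * ((|a| * R) ^ m / (m.factorial : ℝ)) := by
        rw [mul_pow, pow_add, mul_one]; ring
  · simp [summable_zero]

theorem Fser_iter (a : ℝ) (n k : ℕ) :
    iteratedDeriv n (Fser a (k + n)) = Fser a k := by
  induction n with
  | zero => simp
  | succ n ih =>
    rw [iteratedDeriv_succ']
    have : deriv (Fser a (k + (n + 1))) = Fser a (k + n) :=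
      funext fun x => (Fser_hasDerivAt a (k + n) x).deriv
    rw [this, ih]

theorem Fser_bessel (a : ℝ) (ha : 0 < a) (k : ℕ) (y : ℝ) (hy : 0 < y) :
    (√y) ^ k * besselI k (2 * √(a * y)) = (√a) ^ k * Fser a k y := by
  unfold besselI Fser
  rw [← tsum_mul_left, ← tsum_mul_left]
  congr 1
  funext m
  have e : (2 * √(a * y) / 2) ^ (2 * m + k) = (a * y) ^ m * ((√a) ^ k * (√y) ^ k) := by
    rw [mul_div_cancel_left₀ _ (two_ne_zero), pow_add, pow_mul,
      Real.sq_sqrt (by positivity), Real.sqrt_mul ha.le, mul_pow (√a)]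
  have e2 : (√y) ^ k * (√y) ^ k = y ^ k := by
    rw [← mul_pow, Real.mul_self_sqrt hy.le]
  rw [e, pow_add, ← e2, mul_pow]
  ring

theorem rpow_half (y : ℝ) (hy : 0 ≤ y) (k : ℕ) : y ^ ((k : ℝ) / 2) = (√y) ^ k := by
  rw [Real.sqrt_eq_rpow, ← Real.rpow_natCast, ← Real.rpow_mul hy]
  congr 1
  ring

/-- The `n`-th iterated derivative of `F_ν` equals `F_{ν−n}`; equivalently, for
`a, x > 0`, `(d/dx)^n [x^{ν/2} I_ν(2√(ax))] = a^{n/2} x^{(ν−n)/2} I_{ν−n}(2√(ax))`. -/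
theorem stmt6 (a : ℝ) (ν n : ℕ) (hn : n ≤ ν) :
    (∀ x : ℝ, iteratedDeriv n (Fser a ν) x = Fser a (ν - n) x) ∧
    (0 < a → ∀ x : ℝ, 0 < x →
      iteratedDeriv n (fun y : ℝ => y ^ ((ν : ℝ) / 2) * besselI ν (2 * Real.sqrt (a * y))) x
        = a ^ ((n : ℝ) / 2) * x ^ (((ν : ℝ) - (n : ℝ)) / 2) *
            besselI (ν - n) (2 * Real.sqrt (a * x))) := by
  obtain ⟨k, rfl⟩ := Nat.exists_eq_add_of_le' hn
  rw [Nat.add_sub_cancel]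
  refine ⟨fun x => by rw [Fser_iter], fun ha x hx => ?_⟩
  have hev : (fun y : ℝ => y ^ (((k + n : ℕ) : ℝ) / 2) * besselI (k + n) (2 * √(a * y)))
      =ᶠ[nhds x] (fun y => (√a) ^ (k + n) * Fser a (k + n) y) := by
    filter_upwards [lt_mem_nhds hx] with y hy
    rw [rpow_half y hy.le, Fser_bessel a ha _ y hy]
  have hk : ((k + n : ℕ) : ℝ) - (n : ℝ) = (k : ℝ) := by push_cast; ring
  rw [hev.iteratedDeriv_eq n, iteratedDeriv_const_mul_field, Fser_iter, hk, rpow_half a ha.le,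
    rpow_half x hx.le, mul_assoc, Fser_bessel a ha k x hx, pow_add]
  ring
end

section
/- Let N ≥ 1 and, for n = 1,…,N, let β_n ∈ ℝ, θ_n ∈ ℝ and â_n, b̂_n ∈ ℂ. Let ρ₁, ρ₂ ∈ [0,1) and set ρ̄₁² := 1 − ρ₁², ρ̄₂² := 1 − ρ₂². For ω ∈ ℂ set q_n := (|ω|²/4) ρ̄₁² ρ̄₂² β_n². Then the characteristic function of the effective RIS-assisted air-to-ground channel Z(y, w) = ∑_{n=1}^N conj(w_n) β_n e^{iθ_n} y_n, averaged over the complex Gaussian innovations, satisfies ∫_{ℂ^N} ∫_{ℂ^N} exp( i Re( conj(ω) ∑_{n=1}^N conj(w_n) β_n e^{iθ_n} y_n ) ) · ∏_{n=1}^N (π ρ̄₁²)^{−1} exp(−|y_n − ρ₁ â_n|²/ρ̄₁²) · ∏_{n=1}^N (π ρ̄₂²)^{−1} exp(−|w_n − ρ₂ b̂_n|²/ρ̄₂²) dy dw = ∏_{n=1}^N (1 + q_n)^{−1} exp( −(q_n/(1+q_n)) ( ρ₁²|â_n|²/ρ̄₁² + ρ₂²|b̂_n|²/ρ̄₂² )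 + i ρ₁ ρ₂ Re( conj(ω) conj(b̂_n) β_n e^{iθ_n} â_n ) / (1 + q_n) ), where dy and dw denote Lebesgue measure on ℂ^N ≅ ℝ^{2N}. -/
open MeasureTheory Complex

lemma gauss2 (a : ℝ) (ha : 0 < a) (p r d : ℂ) :
    ∫ z : ℂ, Complex.exp (-(a:ℂ) * ((z.re:ℂ)^2 + (z.im:ℂ)^2) + p * z.re + r * z.im + d)
      = (Real.pi / a : ℂ) * Complex.exp (d + (p^2 + r^2) / (4*a)) := by
  have hb : (-(a:ℂ)).re < 0 := by simpa using ha
  have ha' : (a:ℂ) ≠ 0 := by exact_mod_cast ha.ne'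
  have hpi : (Real.pi / a : ℂ) ≠ 0 :=
    div_ne_zero (by exact_mod_cast Real.pi_ne_zero) ha'
  have h1 := Complex.volume_preserving_equiv_real_prod.integral_comp
    Complex.measurableEquivRealProd.measurableEmbedding
    (fun x : ℝ × ℝ => Complex.exp (-(a:ℂ) * (x.1:ℂ)^2 + p * x.1 + d) *
      Complex.exp (-(a:ℂ) * (x.2:ℂ)^2 + r * x.2 + 0))
  have h2 : ∀ z : ℂ, Complex.exp (-(a:ℂ) * ((z.re:ℂ)^2 + (z.im:ℂ)^2) + p * z.re + r * z.im + d)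
      = (fun x : ℝ × ℝ => Complex.exp (-(a:ℂ) * (x.1:ℂ)^2 + p * x.1 + d) *
      Complex.exp (-(a:ℂ) * (x.2:ℂ)^2 + r * x.2 + 0)) (Complex.measurableEquivRealProd z) := by
    intro z
    simp only [Complex.measurableEquivRealProd_apply, ← Complex.exp_add]
    congr 1
    ring
  simp_rw [h2]
  rw [h1, Measure.volume_eq_prod, integral_prod_mul (μ := volume) (ν := volume)
    (fun x : ℝ => Complex.exp (-(a:ℂ) * (x:ℂ)^2 + p * x + d))
    (fun x : ℝ => Complex.exp (-(a:ℂ) * (x:ℂ)^2 + r * x + 0)),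
    integral_cexp_quadratic hb, integral_cexp_quadratic hb, neg_neg]
  have h3 : (Real.pi / a : ℂ) ^ (1/2:ℂ) * (Real.pi / a : ℂ) ^ (1/2:ℂ) = Real.pi / a := by
    rw [← Complex.cpow_add _ _ hpi]; norm_num
  rw [mul_mul_mul_comm, h3, ← Complex.exp_add]
  congr 2
  field_simp
  ring

lemma inner1 (s : ℝ) (hs : 0 < s) (m t : ℂ) :
    ∫ w : ℂ, Complex.exp (Complex.I * ((starRingEnd ℂ w * t).re : ℂ)) *
      ((1 / (Real.pi * s) * Real.exp (-(‖w - m‖) ^ 2 / s) : ℝ) : ℂ)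
    = Complex.exp (Complex.I * ((m.re * t.re + m.im * t.im : ℝ) : ℂ) -
        ((s * (t.re^2 + t.im^2) / 4 : ℝ) : ℂ)) := by
  have hs' : (s:ℂ) ≠ 0 := by exact_mod_cast hs.ne'
  have hpi : (Real.pi:ℂ) ≠ 0 := by exact_mod_cast Real.pi_ne_zero
  have h := gauss2 (1/s) (by positivity) (Complex.I * t.re + 2 * m.re / s)
    (Complex.I * t.im + 2 * m.im / s) (-((m.re:ℂ)^2 + (m.im:ℂ)^2) / s)
  have h2 : ∀ w : ℂ, Complex.exp (Complex.I * ((starRingEnd ℂ w * t).re : ℂ)) *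
      ((1 / (Real.pi * s) * Real.exp (-(‖w - m‖) ^ 2 / s) : ℝ) : ℂ) =
      (1 / (Real.pi * s) : ℂ) * Complex.exp (-((1/s : ℝ):ℂ) * ((w.re:ℂ)^2 + (w.im:ℂ)^2) +
        (Complex.I * t.re + 2 * m.re / s) * w.re + (Complex.I * t.im + 2 * m.im / s) * w.im +
        (-((m.re:ℂ)^2 + (m.im:ℂ)^2) / s)) := by
    intro w
    rw [Complex.sq_norm, Complex.normSq_apply]
    push_cast
    rw [mul_left_comm, ← Complex.exp_add]
    congr 2
    simp
    field_simp
    ring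
  simp_rw [h2]
  rw [integral_const_mul, h, ← mul_assoc]
  have h3 : (1 / (Real.pi * s) : ℂ) * (Real.pi / ((1/s : ℝ):ℂ)) = 1 := by
    push_cast; field_simp
  rw [h3, one_mul]
  congr 1
  push_cast
  field_simp
  ring_nf
  simp only [Complex.I_sq]
  ring

lemma single (s₁ s₂ : ℝ) (hs₁ : 0 < s₁) (hs₂ : 0 < s₂) (m₁ m₂ c : ℂ) (q : ℝ)
    (hq : q = (c.re^2 + c.im^2) / 4 * s₁ * s₂) :
    ∫ y : ℂ, ∫ w : ℂ, Complex.exp (Complex.I * ((starRingEnd ℂ w * (c * y)).re : ℂ)) *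
      ((1 / (Real.pi * s₁) * Real.exp (-(‖y - m₁‖) ^ 2 / s₁) : ℝ) : ℂ) *
      ((1 / (Real.pi * s₂) * Real.exp (-(‖w - m₂‖) ^ 2 / s₂) : ℝ) : ℂ)
    = ((1 + q : ℝ) : ℂ)⁻¹ * Complex.exp
      (((-(q / (1 + q)) * (‖m₁‖^2 / s₁ + ‖m₂‖^2 / s₂) : ℝ) : ℂ) +
        Complex.I * (((starRingEnd ℂ m₂ * (c * m₁)).re / (1 + q) : ℝ) : ℂ)) := by
  have hs1' : (s₁:ℂ) ≠ 0 := by exact_mod_cast hs₁.ne'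
  have hs2' : (s₂:ℂ) ≠ 0 := by exact_mod_cast hs₂.ne'
  have hpi : (Real.pi:ℂ) ≠ 0 := by exact_mod_cast Real.pi_ne_zero
  have hq0 : 0 < 1 + q := by rw [hq]; positivity
  have hq1 : ((1 + q : ℝ) : ℂ) ≠ 0 := by exact_mod_cast hq0.ne'
  have hin : ∀ y : ℂ, ∫ w : ℂ, Complex.exp (Complex.I * ((starRingEnd ℂ w * (c * y)).re : ℂ)) *
      ((1 / (Real.pi * s₁) * Real.exp (-(‖y - m₁‖) ^ 2 / s₁) : ℝ) : ℂ) *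
      ((1 / (Real.pi * s₂) * Real.exp (-(‖w - m₂‖) ^ 2 / s₂) : ℝ) : ℂ) =
      (1 / (Real.pi * s₁) : ℂ) * Complex.exp (-(((1 + q) / s₁ : ℝ):ℂ) * ((y.re:ℂ)^2 + (y.im:ℂ)^2) +
        (Complex.I * (m₂.re * c.re + m₂.im * c.im) + 2 * m₁.re / s₁) * y.re +
        (Complex.I * (m₂.im * c.re - m₂.re * c.im) + 2 * m₁.im / s₁) * y.im +
        (-((m₁.re:ℂ)^2 + (m₁.im:ℂ)^2) / s₁)) := by
    intro y
    simp_rw [mul_right_comm _ (((1 / (Real.pi * s₁) * Real.exp (-(‖y - m₁‖) ^ 2 / s₁) : ℝ) : ℂ)) _]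
    rw [integral_mul_const, inner1 s₂ hs₂, Complex.sq_norm, Complex.normSq_apply]
    push_cast
    rw [mul_left_comm, ← Complex.exp_add]
    congr 2
    rw [hq]
    simp
    field_simp
    ring
  simp_rw [hin]
  rw [integral_const_mul, gauss2 _ (div_pos hq0 hs₁), ← mul_assoc]
  have h3 : (1 / (Real.pi * s₁) : ℂ) * (Real.pi / (((1 + q)/s₁ : ℝ):ℂ)) = ((1 + q : ℝ) : ℂ)⁻¹ := by
    rw [Complex.ofReal_div]; field_simp
  rw [h3]
  congr 2
  rw [Complex.sq_norm, Complex.normSq_apply, Complex.sq_norm, Complex.normSq_apply]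
  simp only [Complex.ofReal_mul, Complex.ofReal_neg, Complex.ofReal_div, Complex.ofReal_add,
    Complex.mul_re, Complex.mul_im, Complex.conj_re, Complex.conj_im, Complex.ofReal_sub,
    Complex.ofReal_one] at hq1 ⊢
  have hqc : (q:ℂ) = ((c.re:ℂ)^2 + (c.im:ℂ)^2) / 4 * s₁ * s₂ := by rw [hq]; push_cast; ring
  field_simp
  ring_nf
  simp only [Complex.I_sq]
  rw [hqc]
  ring

/-- Conditional characteristic function of the effective RIS-assisted air-to-ground channel
`Z = ∑_n conj(h_RD,n) β_n e^{iθ_n} h_UR,n` under channel aging, averaged over the standard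
complex Gaussian innovations of the two hops. -/
theorem stmt9 (N : ℕ) (hN : 1 ≤ N) (β θ : Fin N → ℝ) (ahat bhat : Fin N → ℂ)
    (ρ₁ ρ₂ : ℝ) (hρ₁ : ρ₁ ∈ Set.Ico (0 : ℝ) 1) (hρ₂ : ρ₂ ∈ Set.Ico (0 : ℝ) 1)
    (ω : ℂ) :
    (∫ y : Fin N → ℂ, ∫ w : Fin N → ℂ,
        Complex.exp (Complex.I *
            ((starRingEnd ℂ ω * ∑ n, starRingEnd ℂ (w n) * (β n : ℂ) *
              Complex.exp (Complex.I * (θ n : ℂ)) * y n).re : ℂ)) *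
          (∏ n, ((1 / (Real.pi * (1 - ρ₁ ^ 2)) *
            Real.exp (-(‖y n - (ρ₁ : ℂ) * ahat n‖) ^ 2 / (1 - ρ₁ ^ 2)) : ℝ) : ℂ)) *
          (∏ n, ((1 / (Real.pi * (1 - ρ₂ ^ 2)) *
            Real.exp (-(‖w n - (ρ₂ : ℂ) * bhat n‖) ^ 2 / (1 - ρ₂ ^ 2)) : ℝ) : ℂ)))
      = ∏ n, (((1 + (‖ω‖ ^ 2 / 4) * (1 - ρ₁ ^ 2) * (1 - ρ₂ ^ 2) * β n ^ 2 : ℝ) : ℂ))⁻¹ *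
          Complex.exp
            ((( -(((‖ω‖ ^ 2 / 4) * (1 - ρ₁ ^ 2) * (1 - ρ₂ ^ 2) * β n ^ 2) /
                  (1 + (‖ω‖ ^ 2 / 4) * (1 - ρ₁ ^ 2) * (1 - ρ₂ ^ 2) * β n ^ 2)) *
                (ρ₁ ^ 2 * ‖ahat n‖ ^ 2 / (1 - ρ₁ ^ 2) +
                 ρ₂ ^ 2 * ‖bhat n‖ ^ 2 / (1 - ρ₂ ^ 2)) : ℝ) : ℂ) +
              Complex.I *
                ((ρ₁ * ρ₂ *
                  (starRingEnd ℂ ω * starRingEnd ℂ (bhat n) * (β n : ℂ) *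
                    Complex.exp (Complex.I * (θ n : ℂ)) * ahat n).re /
                  (1 + (‖ω‖ ^ 2 / 4) * (1 - ρ₁ ^ 2) * (1 - ρ₂ ^ 2) * β n ^ 2) : ℝ) : ℂ)) := by
  have hs₁ : 0 < 1 - ρ₁ ^ 2 := by nlinarith [hρ₁.1, hρ₁.2]
  have hs₂ : 0 < 1 - ρ₂ ^ 2 := by nlinarith [hρ₂.1, hρ₂.2]
  set s₁ := 1 - ρ₁ ^ 2
  set s₂ := 1 - ρ₂ ^ 2
  let c : Fin N → ℂ := fun n => starRingEnd ℂ ω * (β n : ℂ) * Complex.exp (Complex.I * (θ n : ℂ))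
  let F : Fin N → ℂ → ℂ → ℂ := fun n y w =>
    Complex.exp (Complex.I * ((starRingEnd ℂ w * (c n * y)).re : ℂ)) *
      ((1 / (Real.pi * s₁) * Real.exp (-(‖y - (ρ₁ : ℂ) * ahat n‖) ^ 2 / s₁) : ℝ) : ℂ) *
      ((1 / (Real.pi * s₂) * Real.exp (-(‖w - (ρ₂ : ℂ) * bhat n‖) ^ 2 / s₂) : ℝ) : ℂ)
  have hF : ∀ y w : Fin N → ℂ, Complex.exp (Complex.I *
            ((starRingEnd ℂ ω * ∑ n, starRingEnd ℂ (w n) * (β n : ℂ) *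
              Complex.exp (Complex.I * (θ n : ℂ)) * y n).re : ℂ)) *
          (∏ n, ((1 / (Real.pi * s₁) *
            Real.exp (-(‖y n - (ρ₁ : ℂ) * ahat n‖) ^ 2 / s₁) : ℝ) : ℂ)) *
          (∏ n, ((1 / (Real.pi * s₂) *
            Real.exp (-(‖w n - (ρ₂ : ℂ) * bhat n‖) ^ 2 / s₂) : ℝ) : ℂ))
      = ∏ n, F n (y n) (w n) := by
    intro y w
    simp only [F, Finset.prod_mul_distrib]
    congr 2
    rw [← Complex.exp_sum, Finset.mul_sum, Complex.re_sum, Complex.ofReal_sum, Finset.mul_sum]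
    congr 1
    refine Finset.sum_congr rfl fun n _ => ?_
    congr 3
    simp only [c]
    ring
  simp_rw [hF]
  have hw : ∀ y : Fin N → ℂ, ∫ w : Fin N → ℂ, ∏ n, F n (y n) (w n) = ∏ n, ∫ w : ℂ, F n (y n) w :=
    fun y => integral_fintype_prod_volume_eq_prod (fun n => F n (y n))
  simp_rw [hw]
  rw [integral_fintype_prod_volume_eq_prod (fun n (y : ℂ) => ∫ w : ℂ, F n y w)]
  refine Finset.prod_congr rfl fun n _ => ?_
  have hc : (c n).re ^ 2 + (c n).im ^ 2 = ‖ω‖ ^ 2 * β n ^ 2 := by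
    have : (c n).re ^ 2 + (c n).im ^ 2 = ‖c n‖ ^ 2 := by
      rw [Complex.sq_norm, Complex.normSq_apply]; ring
    rw [this]
    have he : ‖Complex.exp (Complex.I * (θ n : ℂ))‖ = 1 := by
      rw [mul_comm]; exact Complex.norm_exp_ofReal_mul_I _
    simp only [c, norm_mul, he, RCLike.norm_conj, Complex.norm_real, Real.norm_eq_abs, mul_pow,
      sq_abs]
    ring
  rw [single s₁ s₂ hs₁ hs₂ _ _ (c n) ((‖ω‖ ^ 2 / 4) * s₁ * s₂ * β n ^ 2) (by rw [hc]; ring)]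
  have e1 : (starRingEnd ℂ ((ρ₂ : ℂ) * bhat n) * (c n * ((ρ₁ : ℂ) * ahat n))).re =
      ρ₁ * ρ₂ * (starRingEnd ℂ ω * starRingEnd ℂ (bhat n) * (β n : ℂ) *
                    Complex.exp (Complex.I * (θ n : ℂ)) * ahat n).re := by
    rw [← Complex.re_ofReal_mul]
    congr 1
    simp only [c, map_mul, Complex.conj_ofReal]
    push_cast
    ring
  rw [e1]
  simp only [norm_mul, mul_pow, Complex.norm_real, Real.norm_eq_abs, sq_abs]
end

section
/- Let (Ω, ℱ, P) be a probability space, 𝒢 ⊆ ℱ a sub-σ-algebra, X a 𝒢-measurable real random variable with E|X|³ < ∞, and Y a real random variable with E|Y|³ < ∞. Let k ≥ 0 and γ̄ ∈ ℝ be constants and suppose that almost surely E[Y | 𝒢] = (k + X)·γ̄, E[(Y − E[Y|𝒢])² | 𝒢] = (k + 2X)·γ̄², and E[(Y − E[Y|𝒢])³ | 𝒢] = (2k + 6X)·γ̄³. Then E[Y] = (k + E[X])·γ̄, Var(Y) = (k + Var(X) + 2E[X])·γ̄², and μ₃(Y) = (2k + 6E[X] + 6Var(X) + μ₃(X))·γ̄³.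 -/
open MeasureTheory

lemma aux_int3 {Ω : Type*} {mΩ : MeasurableSpace Ω} (μ : Measure Ω) {f g h : Ω → ℝ}
    (hf : MemLp f 3 μ) (hg : MemLp g 3 μ) (hh : MemLp h 3 μ) :
    Integrable (fun ω => f ω * g ω * h ω) μ := by
  have key : ∀ {u : Ω → ℝ}, MemLp u 3 μ → Integrable (fun ω => ‖u ω‖ ^ 3) μ := by
    intro u hu
    have := hu.integrable_norm_pow (p := 3) (by norm_num)
    simpa using this
  refine Integrable.mono' (((key hf).add (key hg)).add (key hh))
    ((hf.1.mul hg.1).mul hh.1) (Filter.Eventually.of_forall fun ω => ?_)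
  simp only [norm_mul, Pi.add_apply]
  have ha := norm_nonneg (f ω)
  have hb := norm_nonneg (g ω)
  have hc := norm_nonneg (h ω)
  generalize ‖f ω‖ = a at *
  generalize ‖g ω‖ = b at *
  generalize ‖h ω‖ = c at *
  have h0 : 0 ≤ a * b * c := by positivity
  nlinarith [mul_nonneg (add_nonneg (add_nonneg ha hb) hc)
    (add_nonneg (add_nonneg (sq_nonneg (a - b)) (sq_nonneg (b - c))) (sq_nonneg (a - c)))]

lemma aux_pull {Ω : Type*} {mΩ : MeasurableSpace Ω} (μ : Measure Ω) [IsProbabilityMeasure μ]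
    (G : MeasurableSpace Ω) (hG : G ≤ mΩ) {F H h : Ω → ℝ} (hF : Measurable[G] F)
    (hH : Integrable H μ) (hFH : Integrable (fun ω => F ω * H ω) μ)
    (hh : μ[H|G] =ᵐ[μ] h) : ∫ ω, F ω * H ω ∂μ = ∫ ω, F ω * h ω ∂μ := by
  have hp := condExp_mul_of_stronglyMeasurable_left (m := G) hF.stronglyMeasurable hFH hH
  rw [← integral_condExp hG]
  refine integral_congr_ae ?_
  filter_upwards [hp, hh] with ω h1 h2
  rw [← h2]
  exact h1

/-- Total mean, variance and third central moment of a random variable whose conditional law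
given a `𝒢`-measurable `X` is a scaled noncentral chi-square with `2k` d.o.f. and random
noncentrality `2X`. -/
theorem stmt10 {Ω : Type*} {mΩ : MeasurableSpace Ω} (μ : Measure Ω) [IsProbabilityMeasure μ]
    (G : MeasurableSpace Ω) (hG : G ≤ mΩ) (X Y : Ω → ℝ)
    (hXmeas : Measurable[G] X)
    (hX3 : MemLp X 3 μ) (hY3 : MemLp Y 3 μ)
    (k γ : ℝ) (hk : 0 ≤ k)
    (h1 : μ[Y|G] =ᵐ[μ] fun ω => (k + X ω) * γ)
    (h2 : μ[fun ω => (Y ω - (μ[Y|G]) ω) ^ 2|G] =ᵐ[μ] fun ω => (k + 2 * X ω) * γ ^ 2)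
    (h3 : μ[fun ω => (Y ω - (μ[Y|G]) ω) ^ 3|G] =ᵐ[μ] fun ω => (2 * k + 6 * X ω) * γ ^ 3) :
    (∫ ω, Y ω ∂μ) = (k + ∫ ω, X ω ∂μ) * γ ∧
    (∫ ω, (Y ω - ∫ ω', Y ω' ∂μ) ^ 2 ∂μ)
      = (k + (∫ ω, (X ω - ∫ ω', X ω' ∂μ) ^ 2 ∂μ) + 2 * ∫ ω, X ω ∂μ) * γ ^ 2 ∧
    (∫ ω, (Y ω - ∫ ω', Y ω' ∂μ) ^ 3 ∂μ)
      = (2 * k + 6 * (∫ ω, X ω ∂μ) + 6 * (∫ ω, (X ω - ∫ ω', X ω' ∂μ) ^ 2 ∂μ)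
          + (∫ ω, (X ω - ∫ ω', X ω' ∂μ) ^ 3 ∂μ)) * γ ^ 3 := by
  have one3 : MemLp (fun _ : Ω => (1 : ℝ)) 3 μ := memLp_const 1
  have hX := hX3.integrable (by norm_num)
  have hY := hY3.integrable (by norm_num)
  obtain ⟨m, hm⟩ : ∃ m, m = ∫ ω, X ω ∂μ := ⟨_, rfl⟩
  have hEY : (∫ ω, Y ω ∂μ) = (k + m) * γ := by
    rw [← integral_condExp hG, integral_congr_ae h1, integral_mul_const,
      integral_add (integrable_const _) hX]
    simp [hm]
  obtain ⟨C, hC⟩ : ∃ C : Ω → ℝ, C = fun ω => X ω - m := ⟨_, rfl⟩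
  obtain ⟨D, hD⟩ : ∃ D : Ω → ℝ, D = fun ω => Y ω - (k + X ω) * γ := ⟨_, rfl⟩
  have hC3 : MemLp C 3 μ := by rw [hC]; exact hX3.sub (memLp_const m)
  have hW3 : MemLp (fun ω => (k + X ω) * γ) 3 μ := by
    have := ((memLp_const k).add hX3).const_mul γ
    refine this.congr_norm (this.1.congr (.of_forall fun ω => ?_)) (.of_forall fun ω => ?_) <;>
      simp [mul_comm]
  have hD3 : MemLp D 3 μ := by rw [hD]; exact hY3.sub hW3
  have hCm : Measurable[G] C := by rw [hC]; exact hXmeas.sub_const m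
  have hWm : Measurable[G] (fun ω => (k + X ω) * γ) := (hXmeas.const_add k).mul_const γ
  have hWi := hW3.integrable (by norm_num)
  have hCi := hC3.integrable (by norm_num)
  have hDi := hD3.integrable (by norm_num)
  have iDD : Integrable (fun ω => D ω ^ 2) μ := by
    simpa [pow_two] using aux_int3 μ hD3 hD3 one3
  have iCC : Integrable (fun ω => C ω ^ 2) μ := by
    simpa [pow_two] using aux_int3 μ hC3 hC3 one3
  have iCD : Integrable (fun ω => C ω * D ω) μ := by
    simpa using aux_int3 μ hC3 hD3 one3
  have iDDD : Integrable (fun ω => D ω ^ 3) μ := by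
    simpa [pow_succ] using aux_int3 μ hD3 hD3 hD3
  have iCCC : Integrable (fun ω => C ω ^ 3) μ := by
    simpa [pow_succ] using aux_int3 μ hC3 hC3 hC3
  have iCCD : Integrable (fun ω => C ω ^ 2 * D ω) μ := by
    simpa [pow_two] using aux_int3 μ hC3 hC3 hD3
  have iCDD : Integrable (fun ω => C ω * D ω ^ 2) μ := by
    simpa [pow_two, mul_assoc] using aux_int3 μ hC3 hD3 hD3
  have e1 : μ[D|G] =ᵐ[μ] fun _ => 0 := by
    have a := condExp_sub hY hWi G
    rw [condExp_of_stronglyMeasurable hG hWm.stronglyMeasurable hWi] at a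
    rw [hD]
    refine (show _ =ᵐ[μ] _ from a).trans ?_
    filter_upwards [h1] with ω hω
    simp [hω]
  have e2 : μ[fun ω => D ω ^ 2|G] =ᵐ[μ] fun ω => (k + 2 * X ω) * γ ^ 2 := by
    refine (condExp_congr_ae ?_).trans h2
    filter_upwards [h1] with ω hω
    simp [hω, hD]
  have e3 : μ[fun ω => D ω ^ 3|G] =ᵐ[μ] fun ω => (2 * k + 6 * X ω) * γ ^ 3 := by
    refine (condExp_congr_ae ?_).trans h3
    filter_upwards [h1] with ω hω
    simp [hω, hD]
  have vC : ∫ ω, C ω ∂μ = 0 := by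
    rw [hC, integral_sub hX (integrable_const _)]; simp [hm]
  have vDD : ∫ ω, D ω ^ 2 ∂μ = (k + 2 * m) * γ ^ 2 := by
    rw [← integral_condExp hG, integral_congr_ae e2, integral_mul_const,
      integral_add (integrable_const _) (hX.const_mul 2), integral_const_mul]
    simp [hm]
  have vDDD : ∫ ω, D ω ^ 3 ∂μ = (2 * k + 6 * m) * γ ^ 3 := by
    rw [← integral_condExp hG, integral_congr_ae e3, integral_mul_const,
      integral_add (integrable_const _) (hX.const_mul 6)]
    simp [hm, integral_const_mul]
  have vCD : ∫ ω, C ω * D ω ∂μ = 0 := by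
    rw [aux_pull μ G hG hCm hDi iCD e1]; simp
  have vCCD : ∫ ω, C ω ^ 2 * D ω ∂μ = 0 := by
    rw [aux_pull μ G hG (hCm.pow_const 2) hDi iCCD e1]; simp
  have vCDD : ∫ ω, C ω * D ω ^ 2 ∂μ = 2 * γ ^ 2 * ∫ ω, C ω ^ 2 ∂μ := by
    rw [aux_pull μ G hG hCm iDD iCDD e2]
    have : (fun ω => C ω * ((k + 2 * X ω) * γ ^ 2))
        = fun ω => ((k + 2 * m) * γ ^ 2) * C ω + (2 * γ ^ 2) * C ω ^ 2 := by
      funext ω; simp only [hC]; ring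
    rw [this, integral_add (hCi.const_mul _) (iCC.const_mul _), integral_const_mul,
      integral_const_mul, vC]
    ring
  have q2 : (fun ω => (Y ω - (k + m) * γ) ^ 2)
      = fun ω => D ω ^ 2 + (2 * γ) * (C ω * D ω) + γ ^ 2 * C ω ^ 2 := by
    funext ω; simp only [hC, hD]; ring
  have q3 : (fun ω => (Y ω - (k + m) * γ) ^ 3)
      = fun ω => D ω ^ 3 + (3 * γ) * (C ω * D ω ^ 2) + (3 * γ ^ 2) * (C ω ^ 2 * D ω)
        + γ ^ 3 * C ω ^ 3 := by
    funext ω; simp only [hC, hD]; ring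
  have c2 : (fun ω => (X ω - m) ^ 2) = fun ω => C ω ^ 2 := by rw [hC]
  have c3 : (fun ω => (X ω - m) ^ 3) = fun ω => C ω ^ 3 := by rw [hC]
  rw [hEY, ← hm, q2, q3, c2, c3]
  refine ⟨rfl, ?_, ?_⟩
  · rw [integral_add (iDD.fun_add (iCD.const_mul _)) (iCC.const_mul _),
      integral_add iDD (iCD.const_mul _), integral_const_mul, integral_const_mul, vDD, vCD]
    ring
  · rw [integral_add ((iDDD.fun_add (iCDD.const_mul _)).fun_add (iCCD.const_mul _)) (iCCC.const_mul _),
      integral_add (iDDD.fun_add (iCDD.const_mul _)) (iCCD.const_mul _),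
      integral_add iDDD (iCDD.const_mul _), integral_const_mul, integral_const_mul,
      integral_const_mul, vDDD, vCDD, vCCD]
    ring
end

section
/- Moment-based parameter estimators for the noncentral chi-square distribution: let E, V, T > 0 satisfy V² > (1/2)·E·T > (3/4)·V². Define γ̄ := (V − √(V² − E·T/2))/E, λ := (V − E·γ̄)/γ̄², and k := E/γ̄ − λ. Then γ̄ > 0, λ > 0, k > 0, and the three moment equations hold: (k + λ)·γ̄ = E, (k + 2λ)·γ̄² = V, and (2k + 6λ)·γ̄³ = T. -/
/-- Moment-based parameter estimators for the noncentral chi-square distribution: let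
`E, V, T > 0` with `V² > (1/2)ET > (3/4)V²`, and define `γ̄ = (V − √(V² − ET/2))/E`,
`λ = (V − Eγ̄)/γ̄²`, `k = E/γ̄ − λ`. Then `γ̄, λ, k > 0` and the three moment equations
`(k+λ)γ̄ = E`, `(k+2λ)γ̄² = V`, `(2k+6λ)γ̄³ = T` hold. -/
theorem stmt13 (E V T : ℝ) (hE : 0 < E) (hV : 0 < V) (hT : 0 < T)
    (h1 : (1 / 2) * E * T < V ^ 2) (h2 : (3 / 4) * V ^ 2 < (1 / 2) * E * T)
    (γ lam k : ℝ)
    (hγdef : γ = (V - Real.sqrt (V ^ 2 - E * T / 2)) / E)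
    (hlamdef : lam = (V - E * γ) / γ ^ 2)
    (hkdef : k = E / γ - lam) :
    0 < γ ∧ 0 < lam ∧ 0 < k ∧
    (k + lam) * γ = E ∧ (k + 2 * lam) * γ ^ 2 = V ∧ (2 * k + 6 * lam) * γ ^ 3 = T := by
  obtain ⟨s, hs⟩ : ∃ s, s = Real.sqrt (V ^ 2 - E * T / 2) := ⟨_, rfl⟩
  rw [← hs] at hγdef
  have hpos : 0 < V ^ 2 - E * T / 2 := by linarith
  have hs0 : 0 < s := by rw [hs]; exact Real.sqrt_pos.mpr hpos
  have hs2 : s ^ 2 = V ^ 2 - E * T / 2 := by rw [hs]; exact Real.sq_sqrt hpos.le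
  have hsV : 2 * s < V := by nlinarith
  have hg : E * γ = V - s := by rw [hγdef]; field_simp
  have hγ : 0 < γ := by rw [hγdef]; apply div_pos <;> linarith
  have hl : lam * γ ^ 2 = s := by
    rw [hlamdef, hg]; field_simp; ring
  have hkl : (k + lam) * γ = E := by rw [hkdef]; field_simp; ring
  have hk : k * γ ^ 2 = V - 2 * s := by
    linear_combination γ * hkl - hl + hg
  have hγ2 : 0 < γ ^ 2 := by positivity
  refine ⟨hγ, ?_, ?_, hkl, ?_, ?_⟩
  · exact pos_of_mul_pos_left (by rw [hl]; exact hs0) hγ2.le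
  · exact pos_of_mul_pos_left (by rw [hk]; linarith) hγ2.le
  · linear_combination hk + 2 * hl
  · apply mul_left_cancel₀ hE.ne'
    linear_combination 2 * E * γ * hk + 6 * E * γ * hl + 2 * (V + s) * hg - 2 * hs2
end

section
/- Let a, α > 0, and let U and V be independent random variables where U has the Gamma distribution with shape a and rate 1 and V has the Gamma distribution with shape α and rate 1. Then the distribution of the product U·V has density on (0, ∞) given by g_{a,α}(x) := x^{α−1} / (Γ(a)Γ(α)) · ∫₀^∞ t^{a−α−1} e^{−t − x/t} dt; that is, for every Borel set A ⊆ (0,∞), P(U·V ∈ A) = ∫_A g_{a,α}(x) dx. (Up to the Bessel-K integral representation, g_{a,α}(x) = 2 x^{(a+α)/2 − 1} K_{a−α}(2√x)/(Γ(a)Γ(α)), the generalized-K-squared density.) -/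
open MeasureTheory ProbabilityTheory

/-- Density of the product of two independent Gamma(shape, rate 1) random variables with
shapes `a` and `α` (the generalized-K-squared density, up to the Bessel-K representation):
`g_{a,α}(x) = x^{α−1}/(Γ(a)Γ(α)) ∫₀^∞ t^{a−α−1} e^{−t−x/t} dt`. -/
noncomputable def gammaProdDensity (a α x : ℝ) : ℝ :=
  x ^ (α - 1) / (Real.Gamma a * Real.Gamma α) *
    ∫ t in Set.Ioi (0 : ℝ), t ^ (a - α - 1) * Real.exp (-t - x / t)

/-- The product of two independent Gamma(shape `a`, rate 1) and Gamma(shape `α`, rate 1)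
random variables has density `g_{a,α}` on `(0, ∞)`. -/
theorem stmt17 {Ω : Type*} {mΩ : MeasurableSpace Ω} (μ : Measure Ω) [IsProbabilityMeasure μ]
    (a α : ℝ) (ha : 0 < a) (hα : 0 < α) (U V : Ω → ℝ)
    (hU : Measurable U) (hV : Measurable V)
    (hUlaw : Measure.map U μ = gammaMeasure a 1)
    (hVlaw : Measure.map V μ = gammaMeasure α 1)
    (hindep : IndepFun U V μ)
    (A : Set ℝ) (hA : MeasurableSet A) (hA0 : A ⊆ Set.Ioi 0) :
    (μ {ω | U ω * V ω ∈ A}).toReal = ∫ x in A, gammaProdDensity a α x := by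
  have hGa := Real.Gamma_pos_of_pos ha
  have hGα := Real.Gamma_pos_of_pos hα
  have : IsProbabilityMeasure (gammaMeasure a 1) :=
    isProbabilityMeasure_gammaMeasure ha one_pos
  have : IsProbabilityMeasure (gammaMeasure α 1) :=
    isProbabilityMeasure_gammaMeasure hα one_pos
  have hma : Measurable (gammaPDF a 1) := (measurable_gammaPDFReal a 1).ennreal_ofReal
  have hmα : Measurable (gammaPDF α 1) := (measurable_gammaPDFReal α 1).ennreal_ofReal
  set F : ℝ → ENNReal := fun x => ∫⁻ t in Set.Ioi (0 : ℝ),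
    gammaPDF a 1 t * (ENNReal.ofReal |t⁻¹| * gammaPDF α 1 (x / t)) with hF
  have hFm : Measurable F := by
    apply Measurable.lintegral_prod_right'
      (f := fun p : ℝ × ℝ => gammaPDF a 1 p.2 * (ENNReal.ofReal |p.2⁻¹| * gammaPDF α 1 (p.1 / p.2)))
    fun_prop
  have hm : Measurable (fun p : ℝ × ℝ => p.1 * p.2) := by fun_prop
  have h1 : μ {ω | U ω * V ω ∈ A} = ∫⁻ x in A, F x := by
    have e1 : μ {ω | U ω * V ω ∈ A}
        = ((gammaMeasure a 1).prod (gammaMeasure α 1)) ((fun p : ℝ × ℝ => p.1 * p.2) ⁻¹' A) := by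
      rw [← hUlaw, ← hVlaw,
        ← (indepFun_iff_map_prod_eq_prod_map_map hU.aemeasurable hV.aemeasurable).1 hindep,
        Measure.map_apply (hU.prodMk hV) (hm hA)]
      rfl
    rw [e1, Measure.prod_apply (hm hA)]
    conv_lhs => rw [gammaMeasure]
    rw [lintegral_withDensity_eq_lintegral_mul _ hma (measurable_measure_prodMk_left (hm hA))]
    have hne : (fun t : ℝ => (gammaPDF a 1 * fun x => (gammaMeasure α 1)
          (Prod.mk x ⁻¹' ((fun p : ℝ × ℝ => p.1 * p.2) ⁻¹' A))) t)
        =ᵐ[volume] (Set.Ioi (0:ℝ)).indicator (fun t => ∫⁻ x in A,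
          gammaPDF a 1 t * (ENNReal.ofReal |t⁻¹| * gammaPDF α 1 (x / t))) := by
      have h0 : ∀ᵐ t : ℝ, t ≠ 0 := by simp [ae_iff]
      filter_upwards [h0] with t ht
      rcases lt_or_gt_of_ne ht with h | h
      · simp [gammaPDF_of_neg h, h.le]
      · rw [Set.indicator_of_mem (by exact h), lintegral_const_mul _ (by fun_prop),
          lintegral_const_mul _ (by fun_prop)]
        simp only [Pi.mul_apply]
        congr 1
        have hs : MeasurableSet ((fun v : ℝ => t * v) ⁻¹' A) := (by fun_prop : Measurable (fun v : ℝ => t * v)) hA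
        change gammaMeasure α 1 ((fun v : ℝ => t * v) ⁻¹' A) = _
        rw [gammaMeasure, withDensity_apply _ hs, ← lintegral_indicator hs, ← lintegral_indicator hA]
        rw [← smul_eq_mul, ← lintegral_smul_measure, ← Real.map_volume_mul_left ht,
          lintegral_map ((by fun_prop : Measurable (fun x => gammaPDF α 1 (x / t))).indicator hA)
            (by fun_prop)]
        congr 1 with v
        simp only [Set.indicator, Set.mem_preimage]
        rw [mul_div_cancel_left₀ _ ht]
        rfl
    rw [lintegral_congr_ae hne, lintegral_indicator measurableSet_Ioi,
      lintegral_lintegral_swap]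
    apply Measurable.aemeasurable
    unfold Function.uncurry
    fun_prop
  have h2 : ∀ x ∈ A, gammaProdDensity a α x = (F x).toReal := by
    intro x hx
    have hx0 : 0 < x := hA0 hx
    have e : F x = ∫⁻ t in Set.Ioi (0:ℝ), ENNReal.ofReal
        (x ^ (α - 1) / (Real.Gamma a * Real.Gamma α) *
          (t ^ (a - α - 1) * Real.exp (-t - x / t))) := by
      apply setLIntegral_congr_fun measurableSet_Ioi
      intro t (ht : 0 < t)
      have hxt : 0 < x / t := by positivity
      simp only
      rw [gammaPDF_of_nonneg ht.le, gammaPDF_of_nonneg hxt.le, ← ENNReal.ofReal_mul (by positivity),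
        ← ENNReal.ofReal_mul (by positivity)]
      congr 1
      rw [abs_of_pos (by positivity), Real.div_rpow hx0.le ht.le, sub_eq_add_neg (-t), Real.exp_add,
        show a - α - 1 = (a - 1) - (α - 1) - 1 by ring, Real.rpow_sub ht (a - 1 - (α - 1)),
        Real.rpow_sub ht (a - 1), Real.rpow_one]
      have := Real.rpow_pos_of_pos ht (α - 1)
      simp only [Real.one_rpow, one_mul]
      field_simp
    rw [e, gammaProdDensity, ← integral_const_mul, integral_eq_lintegral_of_nonneg_ae]
    · filter_upwards [ae_restrict_mem measurableSet_Ioi] with t ht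
      have ht : 0 < t := ht
      simp only [Pi.zero_apply]
      positivity
    · apply Measurable.aestronglyMeasurable
      fun_prop
  rw [setIntegral_congr_fun hA h2, h1, integral_toReal hFm.aemeasurable]
  apply ae_lt_top hFm
  rw [← h1]
  exact measure_ne_top _ _
end

section
/- Let M ≥ 1 be an integer, K ≥ 0, ρ ∈ [0,1) with ρ̄² := 1 − ρ², and γ̄ₛ > 0. Set γ̄ := γ̄ₛ(Kρ̄² + 1)/(K + 1) and λ* := M K ρ²/(K ρ̄² + 1), and let F(x) := ∫₀^x ∑_{m=0}^{M−1} ϰ_m (1/γ̄) f(M−m, λ*; t/γ̄) dt be the CDF of the ground-to-air SNR. Then F is asymptotically linear at the origin: lim_{x→0⁺} F(x)/x = e^{−M K ρ²/(K ρ̄² + 1)} · (K+1)^M (ρ̄²)^{M−1} / ( (K ρ̄² + 1)^M · γ̄ₛ ). -/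
open MeasureTheory Real Filter

theorem ncx2_eq_aux (n : ℕ) (lam x : ℝ) :
    ncx2 ((n : ℝ) + 1) lam x = Real.exp (-lam) * Real.exp (-x) * x ^ n *
      ∑' j : ℕ, (lam * x) ^ j / ((j.factorial : ℝ) * ((n + j).factorial : ℝ)) := by
  unfold ncx2
  rw [← tsum_mul_left]
  congr 1
  ext j
  have h1 : (n : ℝ) + 1 + (j : ℝ) - 1 = ((n + j : ℕ) : ℝ) := by push_cast; ring
  have h2 : (n : ℝ) + 1 + (j : ℝ) = ((n + j : ℕ) : ℝ) + 1 := by push_cast; ring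
  rw [h1, h2, Real.rpow_natCast, Real.Gamma_nat_eq_factorial, pow_add, mul_pow]
  have := Nat.factorial_ne_zero j
  have := Nat.factorial_ne_zero (n + j)
  field_simp

theorem ncx2_series_cont (n : ℕ) (lam : ℝ) :
    Continuous (fun x : ℝ => ∑' j : ℕ, (lam * x) ^ j /
      ((j.factorial : ℝ) * ((n + j).factorial : ℝ))) := by
  rw [continuous_iff_continuousAt]
  intro x₀
  have hc : ContinuousOn (fun x : ℝ => ∑' j : ℕ, (lam * x) ^ j /
      ((j.factorial : ℝ) * ((n + j).factorial : ℝ))) (Set.Icc (-(|x₀| + 1)) (|x₀| + 1)) := by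
    refine continuousOn_tsum (u := fun j : ℕ => (|lam| * (|x₀| + 1)) ^ j / (j.factorial : ℝ))
      (fun j => by fun_prop) (Real.summable_pow_div_factorial _) ?_
    intro j x hx
    have hx' : |x| ≤ |x₀| + 1 := abs_le.mpr hx
    rw [norm_div, norm_pow, norm_mul, norm_mul, Real.norm_eq_abs, Real.norm_eq_abs,
      Real.norm_natCast, Real.norm_natCast]
    have h1 : (1 : ℝ) ≤ ((n + j).factorial : ℝ) := by exact_mod_cast Nat.factorial_pos _
    have h0 : (0 : ℝ) < (j.factorial : ℝ) := by exact_mod_cast Nat.factorial_pos _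
    have h3 : (j.factorial : ℝ) ≤ (j.factorial : ℝ) * ((n + j).factorial : ℝ) :=
      le_mul_of_one_le_right h0.le h1
    gcongr
  apply hc.continuousAt
  apply Icc_mem_nhds
  · linarith [neg_abs_le x₀]
  · linarith [le_abs_self x₀]

theorem ncx2_cont (n : ℕ) (lam : ℝ) : Continuous (ncx2 ((n : ℝ) + 1) lam) := by
  have h := ncx2_series_cont n lam
  have e : ncx2 ((n : ℝ) + 1) lam = _ := funext (ncx2_eq_aux n lam)
  rw [e]
  fun_prop

theorem ncx2_zero (n : ℕ) (lam : ℝ) :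
    ncx2 ((n : ℝ) + 1) lam 0 = if n = 0 then Real.exp (-lam) else 0 := by
  rw [ncx2_eq_aux]
  split_ifs with h
  · subst h
    rw [tsum_eq_single 0]
    · simp
    · intro j hj
      simp [hj]
  · simp [h]

/-- The CDF of the ground-to-air SNR is asymptotically linear at the origin:
`F(x)/x → e^{−MKρ²/(Kρ̄²+1)} (K+1)^M (ρ̄²)^{M−1} / ((Kρ̄²+1)^M γ̄ₛ)` as `x → 0⁺`. -/
theorem stmt19 (M : ℕ) (hM : 1 ≤ M) (K : ℝ) (hK : 0 ≤ K) (ρ : ℝ)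
    (hρ : ρ ∈ Set.Ico (0 : ℝ) 1) (γs : ℝ) (hγs : 0 < γs) :
    Tendsto (fun x : ℝ =>
        (∫ t in (0 : ℝ)..x, ∑ m ∈ Finset.range M, mixProp M K ρ m *
          ((1 / (γs * (K * (1 - ρ ^ 2) + 1) / (K + 1))) *
            ncx2 ((M : ℝ) - (m : ℝ)) ((M : ℝ) * K * ρ ^ 2 / (K * (1 - ρ ^ 2) + 1))
              (t / (γs * (K * (1 - ρ ^ 2) + 1) / (K + 1))))) / x)
      (nhdsWithin 0 (Set.Ioi 0))
      (nhds (Real.exp (-((M : ℝ) * K * ρ ^ 2 / (K * (1 - ρ ^ 2) + 1))) *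
        (K + 1) ^ M * (1 - ρ ^ 2) ^ (M - 1) / ((K * (1 - ρ ^ 2) + 1) ^ M * γs))) := by
  set lam := (M : ℝ) * K * ρ ^ 2 / (K * (1 - ρ ^ 2) + 1) with hlam
  set g := γs * (K * (1 - ρ ^ 2) + 1) / (K + 1) with hg
  have hd : 0 < K * (1 - ρ ^ 2) + 1 := by
    have : 0 ≤ 1 - ρ ^ 2 := by nlinarith [hρ.1, hρ.2]
    positivity
  have hcast : ∀ m ∈ Finset.range M, (M : ℝ) - (m : ℝ) = ((M - m - 1 : ℕ) : ℝ) + 1 := by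
    intro m hm
    have hm' := Finset.mem_range.mp hm
    have : M = (M - m - 1) + 1 + m := by omega
    have h2 : (M : ℝ) = ((M - m - 1 : ℕ) : ℝ) + 1 + m := by exact_mod_cast this
    linarith
  have hcont : Continuous (fun t : ℝ => ∑ m ∈ Finset.range M, mixProp M K ρ m *
      ((1 / g) * ncx2 ((M : ℝ) - (m : ℝ)) lam (t / g))) := by
    refine continuous_finsetSum _ fun m hm => ?_
    rw [hcast m hm]
    have := ncx2_cont (M - m - 1) lam
    fun_prop
  have hD := (intervalIntegral.integral_hasDerivAt_right
    (hcont.intervalIntegrable 0 0) (hcont.stronglyMeasurableAtFilter _ _) hcont.continuousAt)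
  have hT := hD.tendsto_slope_zero_right
  have hval : (∑ m ∈ Finset.range M, mixProp M K ρ m *
      ((1 / g) * ncx2 ((M : ℝ) - (m : ℝ)) lam (0 / g))) =
      Real.exp (-lam) * (K + 1) ^ M * (1 - ρ ^ 2) ^ (M - 1) /
        ((K * (1 - ρ ^ 2) + 1) ^ M * γs) := by
    obtain ⟨N, rfl⟩ : ∃ N, M = N + 1 := ⟨M - 1, by omega⟩
    rw [Finset.sum_eq_single N]
    · rw [hcast N (by simp), zero_div, ncx2_zero]
      have hK1 : K + 1 ≠ 0 := by positivity
      have hd' := hd.ne'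
      simp only [mixProp, hg]
      simp
      field_simp
      rw [pow_succ (K + 1), pow_succ (_ * K + 1)]
      ring
    · intro m hm hne
      have hm' := Finset.mem_range.mp hm
      rw [hcast m hm, zero_div, ncx2_zero, if_neg (by omega)]
      simp
    · simp
  rw [hval] at hT
  refine hT.congr fun x => ?_
  simp [div_eq_inv_mul]
end
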